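/- There is an absolute constant C > 0 with the following property. Let G be an abelian group, A ⊆ G a finite set with |A| ≥ 4 and dim(A) ≥ 2, K ≥ 1 a real number with |A+A| ≤ K·|A|, and set k* = ⌈dim(A)·log dim(A)⌉. Then dim_{k*}(A) ≤ C·( log|A|/log log|A| + K·log⁶(2K)·log log(4K) ). -/

import Mathlib

open Finset Pointwise

universe u

/-- A finset `Λ` in an abelian group is `k`-dissociated if every integer relation
`∑ ε_λ • λ = 0` with `|ε_λ| ≤ k` forces all `ε_λ = 0`. -/
def IsKDissociated {G : Type*} [AddCommGroup G] (k : ℕ) (Λ : Finset G) : Prop :=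
  ∀ ε : G → ℤ, (∀ x ∈ Λ, |ε x| ≤ (k : ℤ)) → (∑ x ∈ Λ, ε x • x) = 0 → ∀ x ∈ Λ, ε x = 0

/-- `addDim k A` is the maximal size of a `k`-dissociated subset of `A`. -/
noncomputable def addDim {G : Type*} [AddCommGroup G] (k : ℕ) (A : Finset G) : ℕ :=
  sSup {n : ℕ | ∃ Λ : Finset G, Λ ⊆ A ∧ Λ.card = n ∧ IsKDissociated k Λ}

/-- `nFold A n` is the `n`-fold sumset `A + A + ⋯ + A` (`n` summands). -/
def nFold {G : Type*} [AddCommGroup G] [DecidableEq G] (A : Finset G) : ℕ → Finset G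
  | 0 => {0}
  | n + 1 => nFold A n + A

lemma weighted_mgf_le {ι : Type*} [Fintype ι] (w V : ι → ℝ) (hw : ∀ i, 0 ≤ w i)
    (hw1 : ∑ i, w i = 1) (hV : ∀ i, |V i| ≤ 2) (hV0 : ∑ i, w i * V i = 0)
    (t : ℝ) (ht : |t| ≤ 1 / 2) :
    ∑ i, w i * Real.exp (t * V i) ≤ Real.exp (4 * t ^ 2) := by
  have hpt : ∀ i, Real.exp (t * V i) ≤ 1 + t * V i + 4 * t ^ 2 := by
    intro i
    have h1 : |t * V i| ≤ 1 := by
      rw [abs_mul]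
      nlinarith [hV i, abs_nonneg t, abs_nonneg (V i)]
    have h2 := (abs_le.1 (Real.abs_exp_sub_one_sub_id_le h1)).2
    have h3 : (V i) ^ 2 ≤ 4 := by
      rw [← sq_abs]; nlinarith [hV i, abs_nonneg (V i)]
    nlinarith [mul_le_mul_of_nonneg_left h3 (sq_nonneg t)]
  calc ∑ i, w i * Real.exp (t * V i) ≤ ∑ i, w i * (1 + t * V i + 4 * t ^ 2) :=
        Finset.sum_le_sum fun i _ => mul_le_mul_of_nonneg_left (hpt i) (hw i)
    _ = (∑ i, w i) * (1 + 4 * t ^ 2) + t * ∑ i, w i * V i := by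
        rw [Finset.sum_mul, Finset.mul_sum, ← Finset.sum_add_distrib]
        exact Finset.sum_congr rfl fun i _ => by ring
    _ ≤ Real.exp (4 * t ^ 2) := by
        rw [hw1, hV0]
        linarith [Real.add_one_le_exp (4 * t ^ 2)]

open Classical in
lemma weighted_tail_le {ι : Type*} [Fintype ι] (w V : ι → ℝ) (hw : ∀ i, 0 ≤ w i)
    (hw1 : ∑ i, w i = 1) (hV : ∀ i, |V i| ≤ 2) (hV0 : ∑ i, w i * V i = 0)
    (r : ℕ) (ε : ℝ) (hε : 0 ≤ ε) (hε1 : ε ≤ 1) :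
    ∑ f : Fin r → ι, (∏ i, w (f i)) * (if ε * r < ∑ i, V (f i) then 1 else 0) ≤
      Real.exp (-(ε ^ 2 * r / 16)) := by
  have hmgf := weighted_mgf_le w V hw hw1 hV hV0 (ε / 8) (by rw [abs_of_nonneg] <;> linarith)
  have hpt : ∀ f : Fin r → ι, (∏ i, w (f i)) * (if ε * r < ∑ i, V (f i) then 1 else 0) ≤
      Real.exp (-(ε / 8 * (ε * r))) * ∏ i, (w (f i) * Real.exp (ε / 8 * V (f i))) := by
    intro f
    rw [Finset.prod_mul_distrib, ← Real.exp_sum, ← Finset.mul_sum]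
    have hp : 0 ≤ ∏ i, w (f i) := Finset.prod_nonneg fun i _ => hw _
    rw [mul_left_comm, ← Real.exp_add]
    refine mul_le_mul_of_nonneg_left ?_ hp
    split_ifs with h
    · apply Real.one_le_exp
      nlinarith
    · positivity
  calc _ ≤ ∑ f : Fin r → ι,
        Real.exp (-(ε / 8 * (ε * r))) * ∏ i, (w (f i) * Real.exp (ε / 8 * V (f i))) :=
        Finset.sum_le_sum fun f _ => hpt f
    _ = Real.exp (-(ε / 8 * (ε * r))) * (∑ i, w i * Real.exp (ε / 8 * V i)) ^ r := by
        rw [← Finset.mul_sum, Fintype.sum_pow]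
    _ ≤ Real.exp (-(ε / 8 * (ε * r))) * (Real.exp (4 * (ε / 8) ^ 2)) ^ r := by
        gcongr
        exact Finset.sum_nonneg fun i _ => mul_nonneg (hw i) (Real.exp_pos _).le
    _ = Real.exp (-(ε ^ 2 * r / 16)) := by
        rw [← Real.exp_nat_mul, ← Real.exp_add]
        congr 1; ring

open Classical in
/-- Sampling `r` points independently from the weights `w`, the expected number of `y ∈ Y` at which
the empirical mean of `Z y` is off by more than `ε` is exponentially small in `ε ^ 2 * r`. -/
lemma weighted_sampling {ι β : Type*} [Fintype ι] (w : ι → ℝ) (hw : ∀ i, 0 ≤ w i)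
    (hw1 : ∑ i, w i = 1) (Y : Finset β) (Z : β → ι → ℝ) (hZ : ∀ y i, |Z y i| ≤ 1)
    (r : ℕ) (ε : ℝ) (hε : 0 ≤ ε) (hε1 : ε ≤ 1) :
    ∑ f : Fin r → ι, (∏ i, w (f i)) *
      (#{y ∈ Y | ε * r < |∑ i, Z y (f i) - r * ∑ j, w j * Z y j|} : ℝ) ≤
      #Y * (2 * Real.exp (-(ε ^ 2 * r / 16))) := by
  have key : ∀ y, ∑ f : Fin r → ι, (∏ i, w (f i)) *
      (if ε * r < |∑ i, Z y (f i) - r * ∑ j, w j * Z y j| then (1 : ℝ) else 0) ≤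
      2 * Real.exp (-(ε ^ 2 * r / 16)) := by
    intro y
    set μ := ∑ j, w j * Z y j with hμ
    have hμ1 : |μ| ≤ 1 := by
      calc |μ| ≤ ∑ j, |w j * Z y j| := Finset.abs_sum_le_sum_abs _ _
        _ ≤ ∑ j, w j := Finset.sum_le_sum fun j _ => by
            rw [abs_mul, abs_of_nonneg (hw j)]
            exact mul_le_of_le_one_right (hw j) (hZ y j)
        _ = 1 := hw1
    have hV : ∀ i, |Z y i - μ| ≤ 2 := fun i => (abs_sub _ _).trans (by linarith [hZ y i])
    have hV0 : ∑ i, w i * (Z y i - μ) = 0 := by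
      simp only [mul_sub, Finset.sum_sub_distrib]
      rw [← Finset.sum_mul, hw1, ← hμ]; ring
    have h1 := weighted_tail_le w (fun i => Z y i - μ) hw hw1 hV hV0 r ε hε hε1
    have h2 := weighted_tail_le w (fun i => -(Z y i - μ)) hw hw1
      (fun i => by rw [abs_neg]; exact hV i)
      (by simp only [mul_neg, Finset.sum_neg_distrib, hV0, neg_zero]) r ε hε hε1
    calc _ ≤ ∑ f : Fin r → ι, ((∏ i, w (f i)) * (if ε * r < ∑ i, (Z y (f i) - μ) then 1 else 0) +
          (∏ i, w (f i)) * (if ε * r < ∑ i, -(Z y (f i) - μ) then 1 else 0)) := by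
          refine Finset.sum_le_sum fun f _ => ?_
          rw [← mul_add]
          refine mul_le_mul_of_nonneg_left ?_ (Finset.prod_nonneg fun i _ => hw _)
          have e : ∑ i, (Z y (f i) - μ) = ∑ i, Z y (f i) - r * μ := by
            simp [Finset.sum_sub_distrib]
          rw [Finset.sum_neg_distrib, e]
          by_cases h : ε * r < |∑ i, Z y (f i) - r * μ|
          · rw [if_pos h]
            rcases lt_abs.1 h with h' | h'
            · rw [if_pos h']; split_ifs <;> norm_num
            · rw [if_pos h']; split_ifs <;> norm_num
          · rw [if_neg h]; split_ifs <;> norm_num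
      _ ≤ _ := by rw [Finset.sum_add_distrib]; linarith
  calc _ = ∑ y ∈ Y, ∑ f : Fin r → ι, (∏ i, w (f i)) *
      (if ε * r < |∑ i, Z y (f i) - r * ∑ j, w j * Z y j| then (1 : ℝ) else 0) := by
        rw [Finset.sum_comm]
        refine Finset.sum_congr rfl fun f _ => ?_
        rw [← Finset.mul_sum, Finset.sum_boole]
    _ ≤ ∑ y ∈ Y, 2 * Real.exp (-(ε ^ 2 * r / 16)) := Finset.sum_le_sum fun y _ => key y
    _ = _ := by rw [Finset.sum_const, nsmul_eq_mul]

lemma card_nsmul_sub_nsmul_le {G : Type*} [AddCommGroup G] [DecidableEq G] {A : Finset G} {K : ℝ}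
    (hA : A.Nonempty) (hK : (#(A + A) : ℝ) ≤ K * #A) (m n : ℕ) :
    (#(m • A - n • A) : ℝ) ≤ K ^ (m + n) * #A := by
  have h := pluennecke_ruzsa_inequality_nsmul_sub_nsmul_add hA A m n
  have h' : (#(m • A - n • A) : ℝ) ≤ ((#(A + A) : ℝ) / #A) ^ (m + n) * #A := by
    have h1 := (NNRat.cast_le (K := ℝ)).2 h
    push_cast at h1
    exact h1
  have hpos : (0 : ℝ) < #A := by exact_mod_cast hA.card_pos
  refine h'.trans ?_
  gcongr
  rwa [div_le_iff₀ hpos]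

/-- The proportion of `a ∈ A` with `x + a ∈ B`. -/
noncomputable def hitDensity {G : Type*} [AddCommGroup G] [DecidableEq G] (A B : Finset G)
    (x : G) : ℝ := #{a ∈ A | x + a ∈ B} / #A

lemma hitDensity_eq_sum {G : Type*} [AddCommGroup G] [DecidableEq G] (A B : Finset G) (x : G) :
    ∑ a : A, ((#A : ℝ)⁻¹ * if x + a.1 ∈ B then 1 else 0) = hitDensity A B x := by
  rw [← Finset.mul_sum, Finset.sum_coe_sort A (fun a => if x + a ∈ B then (1 : ℝ) else 0),
    Finset.sum_boole, hitDensity, div_eq_inv_mul]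

/-- The set of exceptional points where the sample `c` (a tuple of elements of `A`)
does not compute `hitDensity A (A + A)` up to `ε`. -/
noncomputable def sampleExceptions {G : Type*} [AddCommGroup G] [DecidableEq G] (A : Finset G)
    (ε : ℝ) {κ : ℕ} (c : Fin κ → G) : Finset G :=
  {y ∈ A + A - A | ε * κ <
    |∑ i, (if y + c i ∈ A + A then (1 : ℝ) else 0) - κ * hitDensity A (A + A) y|}

lemma abs_sample_sub_le {G : Type*} [AddCommGroup G] [DecidableEq G] {A : Finset G}
    {ε : ℝ} (hε : 0 ≤ ε) {κ : ℕ} {c : Fin κ → G} (hc : ∀ i, c i ∈ A) {y : G}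
    (hy : y ∉ sampleExceptions A ε c) :
    |∑ i, (if y + c i ∈ A + A then (1 : ℝ) else 0) - κ * hitDensity A (A + A) y| ≤ ε * κ := by
  by_cases h : y ∈ A + A - A
  · by_contra! h'
    exact hy (Finset.mem_filter.2 ⟨h, h'⟩)
  · have h0 : ∀ a ∈ A, y + a ∉ A + A := fun a ha h' =>
      h (by simpa using Finset.sub_mem_sub h' ha)
    have h1 : hitDensity A (A + A) y = 0 := by
      rw [hitDensity, Finset.filter_false_of_mem h0]; simp
    rw [h1, Finset.sum_eq_zero fun i _ => if_neg (h0 _ (hc i))]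
    simp only [mul_zero, sub_zero, abs_zero]
    positivity

open Classical in
lemma card_good_samples {G : Type*} [AddCommGroup G] [DecidableEq G] {A : Finset G} {K : ℝ}
    (hA : A.Nonempty) (hK : (#(A + A) : ℝ) ≤ K * #A) (κ : ℕ) {ε β : ℝ} (hε : 0 ≤ ε) (hε1 : ε ≤ 1)
    (hβ : 0 < β) (h : K ^ 3 * (2 * Real.exp (-(ε ^ 2 * κ / 16))) ≤ β / 2) :
    (#A : ℝ) ^ κ / 2 ≤
      #{c : Fin κ → A | (#(sampleExceptions A ε (fun i => (c i : G))) : ℝ) ≤ β * #A} := by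
  have hn : (0 : ℝ) < #A := by exact_mod_cast hA.card_pos
  have h1 := weighted_sampling (fun _ : A => (#A : ℝ)⁻¹) (fun _ => by positivity)
    (by simp [hn.ne']) (A + A - A)
    (fun y a => if y + a.1 ∈ A + A then (1 : ℝ) else 0) (fun y i => by split_ifs <;> simp) κ ε hε hε1
  simp only [hitDensity_eq_sum, Finset.prod_const, Finset.card_univ, Fintype.card_fin] at h1
  rw [← Finset.mul_sum] at h1
  have h3 : (#(A + A - A) : ℝ) ≤ K ^ 3 * #A := by
    have := card_nsmul_sub_nsmul_le hA hK 2 1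
    simpa [two_nsmul] using this
  have h4 : (#A : ℝ)⁻¹ ^ κ * ∑ c : Fin κ → A, (#(sampleExceptions A ε (fun i => (c i : G))) : ℝ) ≤
      β / 2 * #A := by
    refine h1.trans ?_
    calc (#(A + A - A) : ℝ) * (2 * Real.exp (-(ε ^ 2 * κ / 16)))
        ≤ K ^ 3 * #A * (2 * Real.exp (-(ε ^ 2 * κ / 16))) := by gcongr
      _ = K ^ 3 * (2 * Real.exp (-(ε ^ 2 * κ / 16))) * #A := by ring
      _ ≤ _ := by gcongr
  have h5 : ∑ c : Fin κ → A, (#(sampleExceptions A ε (fun i => (c i : G))) : ℝ) ≤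
      β / 2 * #A * (#A : ℝ) ^ κ := by
    rw [inv_pow, inv_mul_le_iff₀ (by positivity)] at h4
    linarith
  have h6 : (#{c : Fin κ → A | ¬ (#(sampleExceptions A ε (fun i => (c i : G))) : ℝ) ≤ β * #A} : ℝ)
      * (β * #A) ≤ ∑ c : Fin κ → A, (#(sampleExceptions A ε (fun i => (c i : G))) : ℝ) := by
    rw [← nsmul_eq_mul]
    refine (Finset.card_nsmul_le_sum _ _ _ fun c hc => ?_).trans
      (Finset.sum_le_sum_of_subset_of_nonneg (Finset.filter_subset _ _) fun _ _ _ => by positivity)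
    exact (not_le.1 (Finset.mem_filter.1 hc).2).le
  have h7 : (#{c : Fin κ → A | ¬ (#(sampleExceptions A ε (fun i => (c i : G))) : ℝ) ≤ β * #A} : ℝ)
      ≤ (#A : ℝ) ^ κ / 2 := by
    have : 0 < β * #A := by positivity
    refine le_of_mul_le_mul_right (h6.trans (h5.trans (le_of_eq ?_))) this
    ring
  have h8 := Finset.card_filter_add_card_filter_not (s := (Finset.univ : Finset (Fin κ → A)))
    (fun c => (#(sampleExceptions A ε (fun i => (c i : G))) : ℝ) ≤ β * #A)
  have h9 : (#{c : Fin κ → A | (#(sampleExceptions A ε (fun i => (c i : G))) : ℝ) ≤ β * #A} : ℝ) +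
      (#{c : Fin κ → A | ¬ (#(sampleExceptions A ε (fun i => (c i : G))) : ℝ) ≤ β * #A} : ℝ) =
      (#A : ℝ) ^ κ := by
    rw [← Nat.cast_add, h8]; simp
  linarith

open Classical in
/-- Almost periodicity of `hitDensity A (A + A)`: many differences translate it by little. -/
lemma exists_almost_periods {G : Type*} [AddCommGroup G] [DecidableEq G] {A : Finset G} {K : ℝ}
    (hA : A.Nonempty) (hK : (#(A + A) : ℝ) ≤ K * #A) {κ : ℕ} (hκ : 0 < κ) {ε β : ℝ} (hε : 0 ≤ ε)
    (hε1 : ε ≤ 1)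
    (hβ : 0 < β) (h : K ^ 3 * (2 * Real.exp (-(ε ^ 2 * κ / 16))) ≤ β / 2) :
    ∃ T ⊆ A, (#A : ℝ) ≤ 2 * K ^ κ * #T ∧ ∀ s ∈ T - T, ∃ E : Finset G, (#E : ℝ) ≤ 2 * β * #A ∧
      ∀ y ∉ E, |hitDensity A (A + A) (y + s) - hitDensity A (A + A) y| ≤ 2 * ε := by
  have hn : (0 : ℝ) < #A := by exact_mod_cast hA.card_pos
  have hL := card_good_samples hA hK κ hε hε1 hβ h
  set L : Finset (Fin κ → A) :=
    {c : Fin κ → A | (#(sampleExceptions A ε (fun i => (c i : G))) : ℝ) ≤ β * #A} with hLdef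
  have hK0 : 0 < K := by
    have h2 : (0 : ℝ) < #(A + A) := by exact_mod_cast (hA.add hA).card_pos
    exact pos_of_mul_pos_left (h2.trans_le hK) hn.le
  obtain ⟨c, -, hc⟩ : ∃ c ∈ Fintype.piFinset (fun _ : Fin κ => A + A),
      (#A : ℝ) / (2 * K ^ κ) ≤ #{p ∈ L ×ˢ A | (fun i => (p.1 i : G) + p.2) = c} := by
    refine Finset.exists_le_card_fiber_of_nsmul_le_card_of_maps_to
      (f := fun p : (Fin κ → A) × G => fun i => (p.1 i : G) + p.2) ?_ ?_ ?_
    · intro p hp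
      rw [Fintype.mem_piFinset]
      exact fun i => Finset.add_mem_add (p.1 i).2 (Finset.mem_product.1 hp).2
    · rw [Fintype.piFinset_nonempty]
      exact fun _ => hA.add hA
    · rw [nsmul_eq_mul, Fintype.card_piFinset_const, Finset.card_product]
      push_cast
      calc ((#(A + A) : ℝ)) ^ κ * (#A / (2 * K ^ κ)) ≤ (K * #A) ^ κ * (#A / (2 * K ^ κ)) := by gcongr
        _ = (#A : ℝ) ^ κ / 2 * #A := by
            rw [mul_pow]; field_simp
        _ ≤ _ := by gcongr
  set T : Finset G := {t ∈ A | ∃ a ∈ L, (fun i => (a i : G) + t) = c} with hT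
  refine ⟨T, Finset.filter_subset _ _, ?_, ?_⟩
  · have : #{p ∈ L ×ˢ A | (fun i => (p.1 i : G) + p.2) = c} ≤ #T := by
      refine Finset.card_le_card_of_injOn Prod.snd ?_ ?_
      · intro p hp
        obtain ⟨h1, h2⟩ := Finset.mem_filter.1 hp
        exact Finset.mem_filter.2 ⟨(Finset.mem_product.1 h1).2, p.1, (Finset.mem_product.1 h1).1, h2⟩
      · intro p hp q hq hpq
        have h1 := (Finset.mem_filter.1 hp).2
        have h2 := (Finset.mem_filter.1 hq).2
        refine Prod.ext (funext fun i => Subtype.ext ?_) hpq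
        have this : (p.1 i : G) + p.2 = q.1 i + q.2 := congrFun (h1.trans h2.symm) i
        rw [show p.2 = q.2 from hpq] at this
        exact add_right_cancel this
    have h2 : (#A : ℝ) / (2 * K ^ κ) ≤ #T := hc.trans (by exact_mod_cast this)
    rw [div_le_iff₀ (by positivity)] at h2
    linarith
  · have hclose : ∀ t ∈ T, ∃ E : Finset G, (#E : ℝ) ≤ β * #A ∧ ∀ y, y + t ∉ E →
        |∑ i, (if y + c i ∈ A + A then (1 : ℝ) else 0) - κ * hitDensity A (A + A) (y + t)| ≤
          ε * κ := by
      intro t ht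
      obtain ⟨-, a, ha, hac⟩ := Finset.mem_filter.1 ht
      refine ⟨sampleExceptions A ε (fun i => (a i : G)), (Finset.mem_filter.1 ha).2, fun y hy => ?_⟩
      have := abs_sample_sub_le hε (fun i => (a i).2) hy
      rw [← hac]
      simpa [add_assoc, add_comm t] using this
    intro s hs
    obtain ⟨t, ht, t', ht', rfl⟩ := Finset.mem_sub.1 hs
    obtain ⟨E, hE, hE'⟩ := hclose t ht
    obtain ⟨F, hF, hF'⟩ := hclose t' ht'
    refine ⟨E.image (· - (t - t')) ∪ F, ?_, ?_⟩
    · have h1 : #(E.image (· - (t - t')) ∪ F) ≤ #E + #F :=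
        (Finset.card_union_le _ _).trans (Nat.add_le_add_right Finset.card_image_le _)
      have h2 : (#(E.image (· - (t - t')) ∪ F) : ℝ) ≤ #E + #F := by exact_mod_cast h1
      linarith
    · intro y hy
      rw [Finset.mem_union, not_or] at hy
      have h1 := hE' (y - t') (fun h => hy.1 (Finset.mem_image.2 ⟨_, h, by abel⟩))
      have h2 := hF' (y - t') (by simpa using hy.2)
      have e1 : y - t' + t = y + (t - t') := by abel
      rw [e1] at h1
      rw [sub_add_cancel] at h2
      have hκ' : (0 : ℝ) < κ := by exact_mod_cast hκ
      rw [abs_le] at h1 h2 ⊢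
      constructor <;> nlinarith [h1.1, h1.2, h2.1, h2.2]

lemma hitDensity_self {G : Type*} [AddCommGroup G] [DecidableEq G] {A : Finset G}
    {y : G} (hy : y ∈ A) : hitDensity A (A + A) y = 1 := by
  have hA : (#A : ℝ) ≠ 0 := by exact_mod_cast (Finset.card_pos.2 ⟨y, hy⟩).ne'
  rw [hitDensity, Finset.filter_true_of_mem fun a ha => Finset.add_mem_add hy ha, div_self hA]

/-- A Croot–Sisask type statement: `2A - 2A` contains the `m`-fold sumset of a large difference
set. -/
lemma exists_nsmul_sub_subset {G : Type*} [AddCommGroup G] [DecidableEq G] {A : Finset G} {K : ℝ}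
    (hA : A.Nonempty) (hK : (#(A + A) : ℝ) ≤ K * #A) {κ m : ℕ} (hκ : 0 < κ) (hm : 0 < m)
    (h : K ^ 3 * (2 * Real.exp (-((1 / (4 * m : ℝ)) ^ 2 * κ / 16))) ≤ 1 / (8 * m)) :
    ∃ T ⊆ A, (#A : ℝ) ≤ 2 * K ^ κ * #T ∧ m • (T - T) ⊆ 2 • A - 2 • A := by
  have hm' : (1 : ℝ) ≤ m := by exact_mod_cast hm
  have hn : (0 : ℝ) < #A := by exact_mod_cast hA.card_pos
  obtain ⟨T, hTA, hT, hper⟩ := exists_almost_periods hA hK hκ (ε := 1 / (4 * m)) (β := 1 / (4 * m))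
    (by positivity) (by rw [div_le_one (by positivity)]; linarith) (by positivity)
    (h.trans (le_of_eq (by field_simp; norm_num)))
  refine ⟨T, hTA, hT, ?_⟩
  have hind : ∀ j : ℕ, ∀ s ∈ j • (T - T), ∃ E : Finset G, (#E : ℝ) ≤ j * (2 * (1 / (4 * m)) * #A) ∧
      ∀ y ∉ E, |hitDensity A (A + A) (y + s) - hitDensity A (A + A) y| ≤
        j * (2 * (1 / (4 * m))) := by
    intro j
    induction j with
    | zero =>
      intro s hs
      rw [zero_nsmul, Finset.mem_zero] at hs
      subst hs
      exact ⟨∅, by simp, by simp⟩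
    | succ j ih =>
      intro s hs
      rw [succ_nsmul] at hs
      obtain ⟨a, ha, b, hb, rfl⟩ := Finset.mem_add.1 hs
      obtain ⟨E, hE, hE'⟩ := ih a ha
      obtain ⟨F, hF, hF'⟩ := hper b hb
      refine ⟨E ∪ F.image (· - a), ?_, ?_⟩
      · have h1 : #(E ∪ F.image (· - a)) ≤ #E + #F :=
          (Finset.card_union_le _ _).trans (Nat.add_le_add_left Finset.card_image_le _)
        have h2 : (#(E ∪ F.image (· - a)) : ℝ) ≤ #E + #F := by exact_mod_cast h1
        push_cast
        linarith
      · intro y hy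
        rw [Finset.mem_union, not_or] at hy
        have h1 := hE' y hy.1
        have h2 := hF' (y + a) (fun h => hy.2 (Finset.mem_image.2 ⟨_, h, by abel⟩))
        rw [← add_assoc]
        push_cast
        rw [abs_le] at h1 h2 ⊢
        constructor <;> linarith [h1.1, h1.2, h2.1, h2.2]
  intro s hs
  obtain ⟨E, hE, hE'⟩ := hind m s hs
  have hE2 : (#E : ℝ) < #A := by
    refine hE.trans_lt ?_
    have : (m : ℝ) * (2 * (1 / (4 * m)) * #A) = #A / 2 := by field_simp; norm_num
    linarith
  obtain ⟨y, hyA, hyE⟩ := Finset.exists_mem_notMem_of_card_lt_card (by exact_mod_cast hE2)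
  have h1 := hE' y hyE
  rw [hitDensity_self hyA] at h1
  have h2 : (m : ℝ) * (2 * (1 / (4 * m))) = 1 / 2 := by field_simp; norm_num
  rw [h2, abs_le] at h1
  have h3 : hitDensity A (A + A) (y + s) ≠ 0 := by linarith [h1.1]
  have h4 : ({a ∈ A | y + s + a ∈ A + A}).Nonempty := by
    rw [Finset.nonempty_iff_ne_empty]
    intro h0
    exact h3 (by rw [hitDensity, h0]; simp)
  obtain ⟨a, ha⟩ := h4
  obtain ⟨ha, hya⟩ := Finset.mem_filter.1 ha
  rw [two_nsmul]
  have := Finset.sub_mem_sub hya (Finset.add_mem_add hyA ha)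
  have e : y + s + a - (y + a) = s := by abel
  rwa [e] at this

lemma isOfFinAddOrder_addCircle_rat (x : AddCircle (1 : ℚ)) : IsOfFinAddOrder x := by
  induction x using QuotientAddGroup.induction_on with
  | _ q =>
    have h := AddCircle.addOrderOf_coe_rat (p := (1 : ℚ)) (q := q)
    rw [← addOrderOf_pos_iff]
    have e : ((q : ℚ) : AddCircle (1 : ℚ)) = (((q : ℚ) * 1 : ℚ) : AddCircle (1 : ℚ)) := by simp
    have h' : addOrderOf ((q : ℚ) : AddCircle (1 : ℚ)) = q.den := by rw [e]; exact_mod_cast h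
    exact h' ▸ q.pos

/-- Finitely generated abelian groups are residually finite. -/
lemma exists_finite_separating_hom (H : Type u) [AddCommGroup H] [AddGroup.FG H] (S : Finset H) :
    ∃ (V : Type u) (_ : AddCommGroup V) (_ : Finite V) (φ : H →+ V), ∀ s ∈ S, φ s = 0 → s = 0 := by
  have hchar : ∀ s : H, ∃ c : H →+ AddCircle (1 : ℚ), s ≠ 0 → c s ≠ 0 := by
    intro s
    by_cases hs : s = 0
    · exact ⟨0, fun h => absurd hs h⟩
    · obtain ⟨c, hc⟩ := CharacterModule.exists_character_apply_ne_zero_of_ne_zero hs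
      exact ⟨c, fun _ => hc⟩
  choose c hc using hchar
  let φ : H →+ (S → AddCircle (1 : ℚ)) := AddMonoidHom.mk' (fun x s => c s x) (fun a b => by
    ext s; simp)
  have htor : IsAddTorsion φ.range := by
    rintro ⟨x, hx⟩
    rw [← AddSubmonoid.isOfFinAddOrder_coe]
    exact IsOfFinAddOrder.pi fun i => isOfFinAddOrder_addCircle_rat _
  have : Finite φ.range := AddCommGroup.finite_of_fg_isAddTorsion _ htor
  refine ⟨φ.range, inferInstance, inferInstance, φ.rangeRestrict, fun s hs h => ?_⟩
  by_contra hne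
  refine hc s hne ?_
  have h1 : φ s = 0 := congrArg Subtype.val h
  exact congrFun h1 ⟨s, hs⟩

lemma sum_sum_sub_eq {H : Type*} [AddCommGroup H] [DecidableEq H] (X : Finset H) (y : H) :
    ∑ a ∈ X, ∑ b ∈ X, (if y + a - b = 0 then (1 : ℝ) else 0) = #{a ∈ X | y + a ∈ X} := by
  rw [← Finset.sum_boole]
  refine Finset.sum_congr rfl fun a _ => ?_
  simp only [sub_eq_zero]
  rw [Finset.sum_ite_eq]

/-- On a finite set `Y`, the normalised self-overlap of `X` is a convex combination of functions
which are characters on the subgroup generated by `X ∪ Y`. -/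
lemma exists_character_representation {G : Type u} [AddCommGroup G] [DecidableEq G]
    {X : Finset G} (hX : X.Nonempty) (Y : Finset G) :
    ∃ (ι : Type u) (_ : Fintype ι) (w : ι → ℝ) (χ : ι → G → ℂ),
      (∀ i, 0 ≤ w i) ∧ ∑ i, w i = 1 ∧ (∀ i x, ‖χ i x‖ ≤ 1) ∧
      (∀ i, ∀ x ∈ AddSubgroup.closure ((X ∪ Y : Finset G) : Set G),
        ∀ y ∈ AddSubgroup.closure ((X ∪ Y : Finset G) : Set G), χ i (x + y) = χ i x * χ i y) ∧
      ∀ y ∈ Y, ∑ i, w i * (χ i y).re = hitDensity X X y := by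
  classical
  set H := AddSubgroup.closure ((X ∪ Y : Finset G) : Set G) with hH
  have hXH : ∀ x ∈ X, x ∈ H := fun x hx =>
    AddSubgroup.subset_closure (by simp [hx])
  have hYH : ∀ x ∈ Y, x ∈ H := fun x hx =>
    AddSubgroup.subset_closure (by simp [hx])
  have : AddGroup.FG H := by rw [hH]; infer_instance
  have hS : ∀ S : Finset G, ∃ (V : Type u) (_ : AddCommGroup V) (_ : Finite V) (φ : H →+ V),
      ∀ s : H, (s : G) ∈ S → φ s = 0 → s = 0 := by
    intro S
    obtain ⟨V, i1, i2, φ, hφ⟩ := exists_finite_separating_hom H (S.subtype (· ∈ H))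
    exact ⟨V, i1, i2, φ, fun s hs => hφ s (by simpa using hs)⟩
  obtain ⟨V, i1, i2, φ, hφ⟩ := hS (insert 0 Y + X - X)
  have := Fintype.ofFinite V
  let ext : (AddChar V ℂ) → G → ℂ := fun ψ x => if h : x ∈ H then ψ (φ ⟨x, h⟩) else 0
  have hext : ∀ ψ x (h : x ∈ H), ext ψ x = ψ (φ ⟨x, h⟩) := fun ψ x h => dif_pos h
  have hmul : ∀ ψ, ∀ x ∈ H, ∀ y ∈ H, ext ψ (x + y) = ext ψ x * ext ψ y := by
    intro ψ x hx y hy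
    rw [hext ψ x hx, hext ψ y hy, hext ψ _ (H.add_mem hx hy), ← AddChar.map_add_eq_mul, ← map_add]
    rfl
  have hconj : ∀ ψ, ∀ x ∈ H, ext ψ (-x) = (starRingEnd ℂ) (ext ψ x) := by
    intro ψ x hx
    rw [hext ψ x hx, hext ψ _ (H.neg_mem hx), ← AddChar.map_neg_eq_conj, ← map_neg]
    rfl
  have hn : (0 : ℝ) < #X := by exact_mod_cast hX.card_pos
  have hV : (0 : ℝ) < Fintype.card V := by exact_mod_cast Fintype.card_pos
  let w : AddChar V ℂ → ℝ := fun ψ => ‖∑ x ∈ X, ext ψ x‖ ^ 2 / (Fintype.card V * #X)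
  have hrep : ∀ y ∈ insert 0 Y, ∑ ψ, w ψ * (ext ψ y).re = hitDensity X X y := by
    intro y hy
    have hyH : y ∈ H := by
      rcases Finset.mem_insert.1 hy with rfl | h
      · exact H.zero_mem
      · exact hYH y h
    have h1 : ∀ ψ, ((‖∑ x ∈ X, ext ψ x‖ ^ 2 : ℝ) : ℂ) * ext ψ y =
        ∑ a ∈ X, ∑ b ∈ X, ext ψ (y + a - b) := by
      intro ψ
      rw [Complex.ofReal_pow, ← Complex.mul_conj', map_sum, Finset.sum_mul_sum, Finset.sum_mul]
      refine Finset.sum_congr rfl fun a ha => ?_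
      rw [Finset.sum_mul]
      refine Finset.sum_congr rfl fun b hb => ?_
      rw [sub_eq_add_neg, hmul ψ _ (H.add_mem hyH (hXH a ha)) _ (H.neg_mem (hXH b hb)),
        hmul ψ _ hyH _ (hXH a ha), hconj ψ b (hXH b hb)]
      ring
    have h2 : ∑ ψ, ((‖∑ x ∈ X, ext ψ x‖ ^ 2 : ℝ) : ℂ) * ext ψ y =
        ((Fintype.card V * #{a ∈ X | y + a ∈ X} : ℝ) : ℂ) := by
      rw [← sum_sum_sub_eq, Finset.sum_congr rfl fun ψ _ => h1 ψ, Finset.sum_comm]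
      push_cast
      rw [Finset.mul_sum]
      refine Finset.sum_congr rfl fun a ha => ?_
      rw [Finset.sum_comm, Finset.mul_sum]
      refine Finset.sum_congr rfl fun b hb => ?_
      have hH' : y + a - b ∈ H := H.sub_mem (H.add_mem hyH (hXH a ha)) (hXH b hb)
      rw [Finset.sum_congr rfl fun ψ _ => hext ψ _ hH', AddChar.sum_apply_eq_ite]
      have hiff : φ ⟨y + a - b, hH'⟩ = 0 ↔ y + a - b = 0 := by
        constructor
        · intro h
          have := hφ ⟨y + a - b, hH'⟩
            (Finset.sub_mem_sub (Finset.add_mem_add hy ha) hb) h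
          exact congrArg Subtype.val this
        · intro h
          have : (⟨y + a - b, hH'⟩ : H) = 0 := Subtype.ext h
          rw [this, map_zero]
      simp only [hiff]
      split_ifs <;> simp
    have h3 : ∑ ψ, ‖∑ x ∈ X, ext ψ x‖ ^ 2 * (ext ψ y).re =
        Fintype.card V * #{a ∈ X | y + a ∈ X} := by
      have := congrArg Complex.re h2
      rw [Complex.re_sum, Complex.ofReal_re] at this
      simpa only [Complex.re_ofReal_mul] using this
    calc ∑ ψ, w ψ * (ext ψ y).re
        = (∑ ψ, ‖∑ x ∈ X, ext ψ x‖ ^ 2 * (ext ψ y).re) / (Fintype.card V * #X) := by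
          rw [Finset.sum_div]
          exact Finset.sum_congr rfl fun ψ _ => by simp only [w]; ring
      _ = hitDensity X X y := by
          rw [h3, hitDensity]; field_simp
  refine ⟨AddChar V ℂ, inferInstance, w, ext,
    fun i => by positivity, ?_, ?_, hmul, ?_⟩
  · have := hrep 0 (Finset.mem_insert_self _ _)
    have h0 : ∀ ψ, (ext ψ 0).re = 1 := by
      intro ψ
      rw [hext ψ 0 H.zero_mem]
      have : (⟨0, H.zero_mem⟩ : H) = 0 := rfl
      rw [this, map_zero, AddChar.map_zero_eq_one, Complex.one_re]
    simp only [h0, mul_one] at this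
    rw [this, hitDensity, Finset.filter_true_of_mem (by simp), div_self hn.ne']
  · intro i x
    by_cases h : x ∈ H
    · rw [hext _ x h, AddChar.norm_apply]
    · simp [ext, h]
  · intro y hy
    exact hrep y (Finset.mem_insert_of_mem hy)

lemma hitDensity_add_le {G : Type*} [AddCommGroup G] [DecidableEq G] {X : Finset G}
    (hX : X.Nonempty) (x y : G) :
    hitDensity X X x + hitDensity X X y - 1 ≤ hitDensity X X (x + y) := by
  have hn : (0 : ℝ) < #X := by exact_mod_cast hX.card_pos
  have h1 : #{a ∈ X | y + a ∈ X} ≤ #{a ∈ X | x + y + a ∈ X} + #{b ∈ X | ¬ x + b ∈ X} := by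
    have h2 : #{a ∈ X | y + a ∈ X ∧ ¬ x + y + a ∈ X} ≤ #{b ∈ X | ¬ x + b ∈ X} := by
      refine Finset.card_le_card_of_injOn (y + ·) ?_ (add_right_injective y).injOn
      intro a ha
      simp only [Finset.coe_filter, Set.mem_ofPred_eq] at ha ⊢
      exact ⟨ha.2.1, by rw [← add_assoc]; exact ha.2.2⟩
    refine le_trans ?_ (Nat.add_le_add_left h2 _)
    refine le_trans (Finset.card_le_card ?_) (Finset.card_union_le _ _)
    intro a ha
    simp only [Finset.mem_filter, Finset.mem_union] at ha ⊢
    tauto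
  have h3 := Finset.card_filter_add_card_filter_not (s := X) (fun b => x + b ∈ X)
  have h4 : (#{a ∈ X | x + a ∈ X} : ℝ) + #{a ∈ X | y + a ∈ X} - #X ≤ #{a ∈ X | x + y + a ∈ X} := by
    have : #{a ∈ X | x + a ∈ X} + #{a ∈ X | y + a ∈ X} ≤ #{a ∈ X | x + y + a ∈ X} + #X := by omega
    have : (#{a ∈ X | x + a ∈ X} : ℝ) + #{a ∈ X | y + a ∈ X} ≤ #{a ∈ X | x + y + a ∈ X} + #X := by
      exact_mod_cast this
    linarith
  simp only [hitDensity]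
  rw [← add_div, ← div_self hn.ne', ← sub_div]
  gcongr

lemma hitDensity_neg {G : Type*} [AddCommGroup G] [DecidableEq G] (X : Finset G) (x : G) :
    hitDensity X X (-x) = hitDensity X X x := by
  have h : ∀ z : G, #{a ∈ X | z + a ∈ X} ≤ #{a ∈ X | -z + a ∈ X} := by
    intro z
    refine Finset.card_le_card_of_injOn (z + ·) ?_ (add_right_injective z).injOn
    intro a ha
    simp only [Finset.coe_filter, Set.mem_ofPred_eq] at ha ⊢
    exact ⟨ha.2, by simpa using ha.1⟩
  rw [hitDensity, hitDensity, le_antisymm (h x) (by simpa using h (-x))]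

lemma mem_sub_of_hitDensity_pos {G : Type*} [AddCommGroup G] [DecidableEq G] {X : Finset G} {x : G}
    (h : 0 < hitDensity X X x) : x ∈ X - X := by
  have h4 : ({a ∈ X | x + a ∈ X}).Nonempty := by
    rw [Finset.nonempty_iff_ne_empty]
    intro h0
    rw [hitDensity, h0] at h
    simp at h
  obtain ⟨a, ha⟩ := h4
  obtain ⟨ha, hxa⟩ := Finset.mem_filter.1 ha
  simpa using Finset.sub_mem_sub hxa ha

/-- Pigeonhole principle for families of points in the unit polydisc. -/
lemma exists_subset_close {β : Type*} {T : Finset β} {r : ℕ} (h : β → Fin r → ℂ)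
    (hh : ∀ t i, ‖h t i‖ ≤ 1) {M : ℕ} (hM : 0 < M) :
    ∃ T₀ ⊆ T, #T ≤ ((2 * M + 1) ^ 2) ^ r * #T₀ ∧
      ∀ t ∈ T₀, ∀ t' ∈ T₀, ∀ i, ‖h t i - h t' i‖ ≤ 2 / M := by
  classical
  have hM' : (0 : ℝ) < M := by exact_mod_cast hM
  let cell : β → Fin r → ℤ × ℤ := fun t i => (⌊(M : ℝ) * (h t i).re⌋, ⌊(M : ℝ) * (h t i).im⌋)
  have hfloor : ∀ x : ℝ, |x| ≤ 1 → ⌊(M : ℝ) * x⌋ ∈ Finset.Icc (-(M : ℤ)) M := by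
    intro x hx
    rw [abs_le] at hx
    rw [Finset.mem_Icc, Int.le_floor, ← Int.lt_add_one_iff, Int.floor_lt]
    push_cast
    constructor <;> nlinarith
  have hcard : #(Fintype.piFinset fun _ : Fin r => Finset.Icc (-(M : ℤ)) M ×ˢ Finset.Icc (-(M : ℤ)) M)
      = ((2 * M + 1) ^ 2) ^ r := by
    rw [Fintype.card_piFinset_const, Finset.card_product, Int.card_Icc]
    have : ((M : ℤ) + 1 - -M).toNat = 2 * M + 1 := by omega
    rw [this, sq]
  obtain ⟨c, -, hc⟩ := Finset.exists_le_card_fiber_of_nsmul_le_card_of_maps_to (s := T) (f := cell)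
    (t := Fintype.piFinset fun _ : Fin r => Finset.Icc (-(M : ℤ)) M ×ˢ Finset.Icc (-(M : ℤ)) M)
    (b := (#T : ℝ) / ((2 * M + 1) ^ 2) ^ r)
    (fun t _ => by
      rw [Fintype.mem_piFinset]
      exact fun i => Finset.mem_product.2
        ⟨hfloor _ ((Complex.abs_re_le_norm _).trans (hh t i)),
          hfloor _ ((Complex.abs_im_le_norm _).trans (hh t i))⟩)
    (by
      rw [Fintype.piFinset_nonempty]
      exact fun _ => ⟨(0, 0), by simp⟩)
    (by
      rw [nsmul_eq_mul, hcard]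
      push_cast
      rw [mul_div_cancel₀]
      positivity)
  refine ⟨{x ∈ T | cell x = c}, Finset.filter_subset _ _, ?_, ?_⟩
  · rw [div_le_iff₀ (by positivity), mul_comm] at hc
    exact_mod_cast hc
  · intro t ht t' ht' i
    have e := congrFun ((Finset.mem_filter.1 ht).2.trans (Finset.mem_filter.1 ht').2.symm) i
    simp only [cell, Prod.mk.injEq] at e
    have hre := Int.abs_sub_lt_one_of_floor_eq_floor e.1
    have him := Int.abs_sub_lt_one_of_floor_eq_floor e.2
    rw [← mul_sub, abs_mul, abs_of_pos hM'] at hre him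
    refine (Complex.norm_le_abs_re_add_abs_im _).trans ?_
    rw [Complex.sub_re, Complex.sub_im, le_div_iff₀ hM']
    nlinarith

/-- A local Bogolyubov-type statement: if `X` is nearly invariant under translation by the elements
of `T`, then `X - X` contains the `l`-fold sumset of a set which is large compared to `T`. -/
lemma exists_nsmul_subset_of_almost_invariant {G : Type u} [AddCommGroup G] [DecidableEq G]
    {X T : Finset G} (hX : X.Nonempty) (hT : T.Nonempty)
    (hinv : ∀ t ∈ T, (9 / 10 : ℝ) ≤ hitDensity X X t) {l r : ℕ} (hl : 0 < l)
    (hr : (#(X - X + (T - T) + T) : ℝ) * (2 * Real.exp (-((1 / 10 : ℝ) ^ 2 * r / 16))) < #T / 2)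
    (hr0 : 0 < r) :
    ∃ P ⊆ T - T, P.Nonempty ∧ #T ≤ ((40 * l + 1) ^ 2) ^ r * #P ∧ l • P ⊆ X - X := by
  classical
  set Y := X - X + (T - T) + T with hY
  have h0X : (0 : G) ∈ X - X := by
    obtain ⟨x, hx⟩ := hX
    simpa using Finset.sub_mem_sub hx hx
  have h0T : (0 : G) ∈ T - T := by
    obtain ⟨x, hx⟩ := hT
    simpa using Finset.sub_mem_sub hx hx
  have hTY : T ⊆ Y := by
    intro t ht
    have := Finset.add_mem_add (Finset.add_mem_add h0X h0T) ht
    simpa using this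
  obtain ⟨ι, _, w, χ, hw, hw1, hχ1, hχm, hrep⟩ := exists_character_representation hX Y
  have hmem : ∀ t ∈ T, t ∈ AddSubgroup.closure ((X ∪ Y : Finset G) : Set G) := fun t ht =>
    AddSubgroup.subset_closure (by simp [hTY ht])
  set H := AddSubgroup.closure ((X ∪ Y : Finset G) : Set G)
  -- sample characters
  have hsamp := weighted_sampling w hw hw1 Y (fun y i => (χ i y).re)
    (fun y i => (Complex.abs_re_le_norm _).trans (hχ1 i y)) r (1 / 10) (by norm_num) (by norm_num)
  obtain ⟨f, hf⟩ : ∃ f : Fin r → ι,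
      (#{y ∈ Y | (1 / 10 : ℝ) * r < |∑ i, (χ (f i) y).re - r * ∑ j, w j * (χ j y).re|} : ℝ)
        < #T / 2 := by
    by_contra! hcon
    have h1 : ∑ f : Fin r → ι, (∏ i, w (f i)) * ((#T : ℝ) / 2) ≤
        #Y * (2 * Real.exp (-((1 / 10 : ℝ) ^ 2 * r / 16))) := by
      refine le_trans (Finset.sum_le_sum fun f _ => ?_) hsamp
      exact mul_le_mul_of_nonneg_left (hcon f) (Finset.prod_nonneg fun i _ => hw _)
    rw [← Finset.sum_mul, ← Fintype.sum_pow, hw1, one_pow, one_mul] at h1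
    linarith
  set B : Finset G :=
    {y ∈ Y | (1 / 10 : ℝ) * r < |∑ i, (χ (f i) y).re - r * ∑ j, w j * (χ j y).re|}
  have hgood : ∀ y ∈ Y, y ∉ B →
      |∑ i, (χ (f i) y).re - r * hitDensity X X y| ≤ (1 / 10 : ℝ) * r := by
    intro y hy hyB
    by_contra! h
    exact hyB (Finset.mem_filter.2 ⟨hy, by rw [hrep y hy]; exact h⟩)
  obtain ⟨T₀, hT₀, hcard, hclose⟩ := exists_subset_close (T := T) (fun t i => χ (f i) t)
    (fun t i => hχ1 _ _) (M := 20 * l) (by omega)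
  have hT₀ne : T₀.Nonempty := by
    rw [← Finset.card_pos]
    by_contra! h
    have := hT.card_pos
    rw [Nat.le_zero.1 h] at hcard
    omega
  obtain ⟨t₀, ht₀⟩ := hT₀ne
  have hl' : (0 : ℝ) < l := by exact_mod_cast hl
  have hχ0 : ∀ t ∈ T, ∀ t' ∈ T, ∀ i, χ i t = χ i (t - t') * χ i t' := by
    intro t ht t' ht' i
    rw [← hχm i _ (H.sub_mem (hmem t ht) (hmem t' ht')) _ (hmem t' ht'), sub_add_cancel]
  set P := T₀.image (· - t₀) with hP
  have hPT : P ⊆ T - T := by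
    intro p hp
    obtain ⟨t, ht, rfl⟩ := Finset.mem_image.1 hp
    exact Finset.sub_mem_sub (hT₀ ht) (hT₀ ht₀)
  -- translating by an element of `P` changes the sampled characters by little
  have hshift : ∀ p ∈ P, ∀ x ∈ H, ∀ i, ‖χ (f i) (p + x) - χ (f i) x‖ ≤ 1 / (10 * l) := by
    intro p hp x hx i
    obtain ⟨t, ht, rfl⟩ := Finset.mem_image.1 hp
    have h1 := hclose t ht t₀ ht₀ i
    have e : t - t₀ + x = t + (x - t₀) := by abel
    have e' : x = t₀ + (x - t₀) := by abel
    have hxt : x - t₀ ∈ H := H.sub_mem hx (hmem _ (hT₀ ht₀))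
    have h2 : χ (f i) x = χ (f i) t₀ * χ (f i) (x - t₀) := by
      rw [← hχm _ _ (hmem _ (hT₀ ht₀)) _ hxt, ← e']
    change ‖χ (f i) (t - t₀ + x) - χ (f i) x‖ ≤ _
    rw [e, hχm _ _ (hmem _ (hT₀ ht)) _ hxt, h2, ← sub_mul, norm_mul]
    calc ‖χ (f i) t - χ (f i) t₀‖ * ‖χ (f i) (x - t₀)‖ ≤ 2 / ((20 * l : ℕ) : ℝ) * 1 :=
          mul_le_mul h1 (hχ1 _ _) (norm_nonneg _) (by positivity)
      _ = 1 / (10 * l) := by push_cast; field_simp; norm_num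
  have hPH : ∀ p ∈ P, p ∈ H := by
    intro p hp
    obtain ⟨t, ht, rfl⟩ := Finset.mem_image.1 hp
    exact H.sub_mem (hmem _ (hT₀ ht)) (hmem _ (hT₀ ht₀))
  have hnshift : ∀ j : ℕ, ∀ z ∈ j • P, z ∈ H ∧ ∀ x ∈ H, ∀ i,
      ‖χ (f i) (z + x) - χ (f i) x‖ ≤ j * (1 / (10 * l)) := by
    intro j
    induction j with
    | zero =>
      intro z hz
      rw [zero_nsmul, Finset.mem_zero] at hz
      subst hz
      exact ⟨H.zero_mem, by simp⟩
    | succ j ih =>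
      intro z hz
      rw [succ_nsmul] at hz
      obtain ⟨a, ha, p, hp, rfl⟩ := Finset.mem_add.1 hz
      refine ⟨H.add_mem (ih a ha).1 (hPH p hp), fun x hx i => ?_⟩
      have h1 := (ih a ha).2 (p + x) (H.add_mem (hPH p hp) hx) i
      have h2 := hshift p hp x hx i
      rw [add_assoc]
      calc _ ≤ ‖χ (f i) (a + (p + x)) - χ (f i) (p + x)‖ + ‖χ (f i) (p + x) - χ (f i) x‖ :=
            norm_sub_le_norm_sub_add_norm_sub _ _ _
        _ ≤ _ := by push_cast; linarith
  have hr' : (0 : ℝ) < r := by exact_mod_cast hr0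
  have hmain : ∀ j : ℕ, j ≤ l → ∀ z ∈ j • P, (1 / 2 : ℝ) ≤ hitDensity X X z := by
    intro j
    induction j with
    | zero =>
      intro _ z hz
      rw [zero_nsmul, Finset.mem_zero] at hz
      subst hz
      have hn : (0 : ℝ) < #X := by exact_mod_cast hX.card_pos
      rw [hitDensity, Finset.filter_true_of_mem (by simp), div_self hn.ne']
      norm_num
    | succ j ih =>
      intro hj z hz
      obtain ⟨hzH, hzs⟩ := hnshift (j + 1) z hz
      have hzY : ∀ t ∈ T, z + t ∈ Y := by
        intro t ht
        rw [succ_nsmul] at hz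
        obtain ⟨a, ha, p, hp, rfl⟩ := Finset.mem_add.1 hz
        have := ih (by omega) a ha
        exact Finset.add_mem_add (Finset.add_mem_add
          (mem_sub_of_hitDensity_pos (by linarith)) (hPT hp)) ht
      obtain ⟨t, ht, htB, hztB⟩ : ∃ t ∈ T, t ∉ B ∧ z + t ∉ B := by
        by_contra! hcon
        have h1 : T ⊆ B ∪ B.image (· - z) := by
          intro t ht
          by_cases h : t ∈ B
          · exact Finset.mem_union_left _ h
          · exact Finset.mem_union_right _ (Finset.mem_image.2 ⟨z + t, hcon t ht h, by abel⟩)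
        have h2 : #T ≤ #B + #B := (Finset.card_le_card h1).trans
          ((Finset.card_union_le _ _).trans (Nat.add_le_add_left Finset.card_image_le _))
        have h3 : (#T : ℝ) ≤ #B + #B := by exact_mod_cast h2
        linarith
      have h1 := (abs_le.1 (hgood t (hTY ht) htB)).1
      have h2 := (abs_le.1 (hgood (z + t) (hzY t ht) hztB)).2
      have h3 : ∑ i, (χ (f i) t).re - ∑ i, (χ (f i) (z + t)).re ≤ (1 / 10 : ℝ) * r := by
        rw [← Finset.sum_sub_distrib]
        calc ∑ i, ((χ (f i) t).re - (χ (f i) (z + t)).re) ≤ ∑ _i : Fin r, (1 / 10 : ℝ) := by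
              refine Finset.sum_le_sum fun i _ => ?_
              have h4 := hzs t (hmem t ht) i
              have h5 : ((j + 1 : ℕ) : ℝ) * (1 / (10 * l)) ≤ 1 / 10 := by
                have : ((j + 1 : ℕ) : ℝ) ≤ l := by exact_mod_cast hj
                rw [mul_one_div, div_le_div_iff₀ (by positivity) (by norm_num)]
                linarith
              have h6 := (abs_le.1 (Complex.abs_re_le_norm (χ (f i) (z + t) - χ (f i) t))).1
              rw [Complex.sub_re] at h6
              linarith
          _ = (1 / 10 : ℝ) * r := by simp [mul_comm]
      have h7 : hitDensity X X t - 3 / 10 ≤ hitDensity X X (z + t) := by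
        refine le_of_mul_le_mul_left ?_ hr'
        linarith
      have h8 := hitDensity_add_le hX (z + t) (-t)
      rw [hitDensity_neg, add_neg_cancel_right] at h8
      have h9 := hinv t ht
      linarith
  refine ⟨P, hPT, ⟨_, Finset.mem_image_of_mem _ ht₀⟩, ?_, ?_⟩
  · rw [hP, Finset.card_image_of_injective _ (sub_left_injective)]
    convert hcard using 4
    ring
  · intro z hz
    have := hmain l le_rfl z hz
    exact mem_sub_of_hitDensity_pos (by linarith)

lemma nsmul_sub_nsmul_add {G : Type*} [AddCommGroup G] [DecidableEq G] (A : Finset G)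
    (a b c d : ℕ) : (a • A - b • A) + (c • A - d • A) = (a + c) • A - (b + d) • A := by
  rw [add_nsmul, add_nsmul, add_sub_add_comm]

lemma nsmul_sub_nsmul_sub {G : Type*} [AddCommGroup G] [DecidableEq G] (A : Finset G)
    (a b c d : ℕ) : (a • A - b • A) - (c • A - d • A) = (a + d) • A - (b + c) • A := by
  rw [← nsmul_sub_nsmul_add, sub_eq_add_neg _ (c • A - d • A), neg_sub]

lemma two_pow_le_exp (n : ℕ) : (2 : ℝ) ^ n ≤ Real.exp n := by
  have h := Real.add_one_le_exp (1 : ℝ)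
  calc (2 : ℝ) ^ n ≤ Real.exp 1 ^ n := by gcongr; linarith
    _ = Real.exp n := by rw [← Real.exp_nat_mul, mul_one]

/-- Translating by elements of `S` moves few points of `X` out of `X` when `X + S` is small. -/
lemma hitDensity_self_ge {G : Type*} [AddCommGroup G] [DecidableEq G] {X S : Finset G}
    (hX : X.Nonempty) (hS : 0 ∈ S) (h : (#(X + S) : ℝ) ≤ 11 / 10 * #X) {s : G} (hs : s ∈ S) :
    (9 / 10 : ℝ) ≤ hitDensity X X s := by
  have hn : (0 : ℝ) < #X := by exact_mod_cast hX.card_pos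
  rw [hitDensity, le_div_iff₀ hn]
  have h1 : #X + #{a ∈ X | ¬ s + a ∈ X} ≤ #(X + S) := by
    have hinj : #({a ∈ X | ¬ s + a ∈ X}.image (s + ·)) = #{a ∈ X | ¬ s + a ∈ X} :=
      Finset.card_image_of_injective _ (add_right_injective s)
    rw [← hinj, ← Finset.card_union_of_disjoint]
    · refine Finset.card_le_card (Finset.union_subset ?_ ?_)
      · exact fun x hx => by simpa using Finset.add_mem_add hx hS
      · intro x hx
        obtain ⟨a, ha, rfl⟩ := Finset.mem_image.1 hx
        rw [add_comm]
        exact Finset.add_mem_add hs (Finset.mem_filter.1 ha).1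
    · rw [Finset.disjoint_left]
      intro x hx hx'
      obtain ⟨a, ha, rfl⟩ := Finset.mem_image.1 hx'
      exact (Finset.mem_filter.1 ha).2 hx
  have h2 := Finset.card_filter_add_card_filter_not (s := X) (fun a => s + a ∈ X)
  have h3 : (#X : ℝ) + #X ≤ #(X + S) + #{a ∈ X | s + a ∈ X} := by
    have : #X + #X ≤ #(X + S) + #{a ∈ X | s + a ∈ X} := by omega
    exact_mod_cast this
  linarith

/-- If `m • S` is contained in `2A - 2A` with `m` large in terms of the doubling of `A`, then
some `A + j • S` is almost invariant under `S`. -/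
lemma exists_almost_invariant {G : Type*} [AddCommGroup G] [DecidableEq G] {A S : Finset G} {K : ℝ}
    (hA : A.Nonempty) (hK : (#(A + A) : ℝ) ≤ K * #A) {b : ℕ} (hb : 1 ≤ b) (hK0 : 0 ≤ K)
    (hKb : K ≤ 2 ^ b)
    (hS : 0 ∈ S) (hmS : (40 * b) • S ⊆ 2 • A - 2 • A) :
    ∃ X ⊆ 3 • A - 2 • A, X.Nonempty ∧ (#(X + S) : ℝ) ≤ 11 / 10 * #X := by
  have hn : (0 : ℝ) < #A := by exact_mod_cast hA.card_pos
  have hsub : ∀ j ≤ 40 * b, A + j • S ⊆ 3 • A - 2 • A := by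
    intro j hj
    have h1 : A + j • S ⊆ (1 • A - 0 • A) + (2 • A - 2 • A) := by
      refine Finset.add_subset_add (by simp) ?_
      exact (Finset.nsmul_subset_nsmul_right hS hj).trans hmS
    rwa [nsmul_sub_nsmul_add] at h1
  by_contra! hcon
  have hgrow : ∀ j ≤ 40 * b, (11 / 10 : ℝ) ^ j * #A ≤ #(A + j • S) := by
    intro j
    induction j with
    | zero => simp
    | succ j ih =>
      intro hj
      have h1 := ih (by omega)
      have h2 := hcon (A + j • S) (hsub j (by omega)) (hA.add (Finset.Nonempty.nsmul ⟨0, hS⟩))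
      rw [succ_nsmul, ← add_assoc, pow_succ]
      linarith
  have h1 := hgrow (40 * b) le_rfl
  have h2 : (#(A + (40 * b) • S) : ℝ) ≤ #(3 • A - 2 • A) := by
    exact_mod_cast Finset.card_le_card (hsub _ le_rfl)
  have h3 := card_nsmul_sub_nsmul_le hA hK 3 2
  have h4 : (11 / 10 : ℝ) ^ (40 * b) ≤ K ^ 5 :=
    le_of_mul_le_mul_right (h1.trans (h2.trans h3)) hn
  have h5 : K ^ 5 ≤ 32 ^ b := by
    calc K ^ 5 ≤ ((2 : ℝ) ^ b) ^ 5 := by gcongr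
      _ = 32 ^ b := by rw [← pow_mul, mul_comm, pow_mul]; norm_num
  have h6 : (32 : ℝ) ^ b < (11 / 10 : ℝ) ^ (40 * b) := by
    rw [pow_mul]
    exact pow_lt_pow_left₀ (by norm_num) (by norm_num) (by omega)
  linarith

/-- For a set of doubling at most `2 ^ b` there is a large `P` all of whose `l`-fold sums lie in
`5A - 5A`; the loss in density is only polynomial in `l`. -/
lemma exists_large_nsmul_subset : ∃ c : ℕ, ∀ {G : Type u} [AddCommGroup G] [DecidableEq G]
    {A : Finset G} {K : ℝ} {b l : ℕ}, A.Nonempty → (#(A + A) : ℝ) ≤ K * #A → 1 ≤ b → 0 ≤ K →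
    K ≤ 2 ^ b → 0 < l →
    ∃ P ⊆ 2 • A - 2 • A, P.Nonempty ∧ l • P ⊆ 5 • A - 5 • A ∧
      (#A : ℝ) ≤ (64 * l : ℝ) ^ (c * b ^ 4) * #P := by
  refine ⟨1 + 5734400 + 3200 * (5734400 + 20), ?_⟩
  intro G _ _ A K b l hA hK hb hK0 hKb hl
  have hn : (0 : ℝ) < #A := by exact_mod_cast hA.card_pos
  have hb' : (1 : ℝ) ≤ b := by exact_mod_cast hb
  have hl' : (1 : ℝ) ≤ l := by exact_mod_cast hl
  obtain ⟨κ, hκ⟩ : ∃ κ : ℕ, κ = 256 * (40 * b) ^ 2 * (14 * b) := ⟨_, rfl⟩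
  have hKpow : ∀ j : ℕ, K ^ j ≤ 2 ^ (b * j) := by
    intro j
    rw [pow_mul]
    gcongr
  obtain ⟨T, hTA, hT, hmT⟩ := exists_nsmul_sub_subset hA hK (κ := κ) (m := 40 * b)
    (by rw [hκ]; positivity) (by positivity) (by
      have e1 : ((1 / (4 * (40 * b : ℕ) : ℝ)) ^ 2 * κ / 16) = ((14 * b : ℕ) : ℝ) := by
        rw [hκ]; push_cast; field_simp; norm_num
      rw [e1, Real.exp_neg]
      have h1 := two_pow_le_exp (14 * b)
      have h2 : K ^ 3 * (16 * (40 * b)) ≤ (2 : ℝ) ^ (14 * b) := by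
        have h3 : (b : ℝ) ≤ 2 ^ b := by exact_mod_cast Nat.lt_two_pow_self.le
        calc K ^ 3 * (16 * (40 * b)) ≤ 2 ^ (b * 3) * (2 ^ 10 * 2 ^ b) := by
              refine mul_le_mul (hKpow 3) ?_ (by positivity) (by positivity)
              linarith
          _ = (2 : ℝ) ^ (b * 3 + (10 + b)) := by rw [pow_add, pow_add]
          _ ≤ _ := pow_le_pow_right₀ (by norm_num) (by omega)
      have h4 := h2.trans h1
      have h5 : (0 : ℝ) < Real.exp ((14 * b : ℕ) : ℝ) := Real.exp_pos _
      rw [le_div_iff₀ (by positivity)]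
      push_cast at *
      calc K ^ 3 * (2 * (Real.exp (14 * b))⁻¹) * (8 * (40 * b))
          = K ^ 3 * (16 * (40 * b)) * (Real.exp (14 * b))⁻¹ := by ring
        _ ≤ Real.exp (14 * b) * (Real.exp (14 * b))⁻¹ := by gcongr
        _ = 1 := mul_inv_cancel₀ h5.ne')
  have hTne : T.Nonempty := by
    rw [Finset.nonempty_iff_ne_empty]
    rintro rfl
    simp only [Finset.card_empty, Nat.cast_zero, mul_zero] at hT
    linarith
  have hS0 : 0 ∈ T - T := by
    obtain ⟨t, ht⟩ := hTne
    simpa using Finset.sub_mem_sub ht ht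
  have hSA : T - T ⊆ 1 • A - 1 • A := by
    rw [one_nsmul]; exact Finset.sub_subset_sub hTA hTA
  obtain ⟨X, hXA, hXne, hX⟩ := exists_almost_invariant hA hK hb hK0 hKb hS0 hmT
  generalize hSdef : T - T = S at *
  have hTS : (#T : ℝ) ≤ #S := by
    rw [← hSdef]
    exact_mod_cast Finset.card_le_card_sub_right hTne
  have hAS : (#A : ℝ) ≤ 2 ^ (1 + b * κ) * #S := by
    calc (#A : ℝ) ≤ 2 * K ^ κ * #T := hT
      _ ≤ 2 * 2 ^ (b * κ) * #S := by
        have := hKpow κ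
        gcongr
      _ = _ := by rw [pow_add, pow_one]
  have hSpos : (0 : ℝ) < #S := by exact_mod_cast Finset.card_pos.2 ⟨0, hS0⟩
  have hY : (#(X - X + (S - S) + S) : ℝ) ≤ 2 ^ (b * 16) * #A := by
    have h1 : X - X + (S - S) + S ⊆ 8 • A - 8 • A := by
      have h2 := Finset.add_subset_add (Finset.add_subset_add (Finset.sub_subset_sub hXA hXA)
        (Finset.sub_subset_sub hSA hSA)) hSA
      simpa only [nsmul_sub_nsmul_sub, nsmul_sub_nsmul_add] using h2
    have h3 : (#(X - X + (S - S) + S) : ℝ) ≤ #(8 • A - 8 • A) := by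
      exact_mod_cast Finset.card_le_card h1
    have h4 := hKpow 16
    calc _ ≤ K ^ 16 * (#A : ℝ) := h3.trans (card_nsmul_sub_nsmul_le hA hK 8 8)
      _ ≤ _ := by gcongr
  obtain ⟨P, hPS, hPne, hPcard, hlP⟩ := exists_nsmul_subset_of_almost_invariant hXne ⟨0, hS0⟩
    (fun s hs => hitDensity_self_ge hXne hS0 hX hs) hl (r := 1600 * (b * κ + 20 * b)) (by
      have e1 : ((1 / 10 : ℝ) ^ 2 * (1600 * (b * κ + 20 * b) : ℕ) / 16) =
          ((b * κ + 20 * b : ℕ) : ℝ) := by push_cast; ring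
      rw [e1, Real.exp_neg]
      have h1 := two_pow_le_exp (b * κ + 20 * b)
      calc (#(X - X + (S - S) + S) : ℝ) * (2 * (Real.exp ((b * κ + 20 * b : ℕ) : ℝ))⁻¹)
          ≤ (2 ^ (b * 16) * (2 ^ (1 + b * κ) * #S)) * (2 * (2 ^ (b * κ + 20 * b))⁻¹) := by
            gcongr
            exact hY.trans (by gcongr)
        _ = #S * (2 ^ (b * 16 + (1 + b * κ) + 1) * (2 ^ (b * κ + 20 * b))⁻¹) := by
            rw [pow_succ, pow_add _ (b * 16)]; ring
        _ < #S * (1 / 2) := by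
            gcongr
            rw [← div_eq_mul_inv, div_lt_div_iff₀ (by positivity) (by norm_num), one_mul,
              ← pow_succ]
            exact pow_lt_pow_right₀ (by norm_num) (by omega)
        _ = #S / 2 := by ring) (by positivity)
  refine ⟨P, ?_, hPne, ?_, ?_⟩
  · have := hPS.trans (Finset.sub_subset_sub hSA hSA)
    simpa only [nsmul_sub_nsmul_sub] using this
  · have := hlP.trans (Finset.sub_subset_sub hXA hXA)
    simpa only [nsmul_sub_nsmul_sub] using this
  · have h1 : (#S : ℝ) ≤ ((40 * l + 1) ^ 2) ^ (1600 * (b * κ + 20 * b)) * #P := by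
      exact_mod_cast hPcard
    have h2 : (0 : ℝ) < #P := by exact_mod_cast hPne.card_pos
    calc (#A : ℝ) ≤ 2 ^ (1 + b * κ) *
          (((40 * l + 1) ^ 2) ^ (1600 * (b * κ + 20 * b)) * #P) := hAS.trans (by gcongr)
      _ ≤ (64 * l) ^ (1 + b * κ) * (((64 * l) ^ 2) ^ (1600 * (b * κ + 20 * b)) * #P) := by
        gcongr <;> linarith
      _ = (64 * l : ℝ) ^ (1 + b * κ + 2 * (1600 * (b * κ + 20 * b))) * #P := by
        rw [← pow_mul, pow_add _ (1 + b * κ), mul_assoc]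
      _ ≤ _ := by
        gcongr
        · linarith
        · have h3 : 1 ≤ b ^ 4 := Nat.one_le_pow _ _ hb
          have h4 : b ≤ b ^ 4 := Nat.le_self_pow (by norm_num) b
          have h5 : b * κ = 5734400 * b ^ 4 := by rw [hκ]; ring
          rw [h5]
          omega

/-- The set of integer combinations of elements of `U` with coefficients in `[-N, N]`. -/
noncomputable def intBox {G : Type*} [AddCommGroup G] [DecidableEq G] (U : Finset G) (N : ℕ) : Finset G :=
  (Fintype.piFinset fun _ : U => Finset.Icc (-(N : ℤ)) N).image fun c => ∑ u, c u • u.1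

lemma mem_intBox {G : Type*} [AddCommGroup G] [DecidableEq G] {U : Finset G} {N : ℕ} {z : G} :
    z ∈ intBox U N ↔ ∃ c : G → ℤ, (∀ u ∈ U, |c u| ≤ N) ∧ ∑ u ∈ U, c u • u = z := by
  simp only [intBox, Finset.mem_image, Fintype.mem_piFinset, Finset.mem_Icc, ← abs_le]
  constructor
  · rintro ⟨c, hc, rfl⟩
    refine ⟨fun x => if h : x ∈ U then c ⟨x, h⟩ else 0, fun u hu => by simpa [hu] using hc ⟨u, hu⟩, ?_⟩
    rw [← Finset.sum_coe_sort]
    simp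
  · rintro ⟨c, hc, rfl⟩
    exact ⟨fun u => c u, fun u => hc u u.2, Finset.sum_coe_sort U fun u => c u • u⟩

lemma card_intBox_le {G : Type*} [AddCommGroup G] [DecidableEq G] (U : Finset G) (N : ℕ) :
    #(intBox U N) ≤ (2 * N + 1) ^ #U := by
  refine Finset.card_image_le.trans (le_of_eq ?_)
  rw [Fintype.card_piFinset, Finset.prod_const, Finset.card_univ, Fintype.card_coe, Int.card_Icc]
  congr 1
  omega

lemma zero_mem_intBox {G : Type*} [AddCommGroup G] [DecidableEq G] (U : Finset G) (N : ℕ) :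
    0 ∈ intBox U N :=
  mem_intBox.2 ⟨0, by simp, by simp⟩

lemma intBox_mono {G : Type*} [AddCommGroup G] [DecidableEq G] {U V : Finset G} (h : U ⊆ V)
    {M N : ℕ} (hMN : M ≤ N) : intBox U M ⊆ intBox V N := by
  intro z hz
  obtain ⟨c, hc, rfl⟩ := mem_intBox.1 hz
  refine mem_intBox.2 ⟨fun x => if x ∈ U then c x else 0, fun u _ => ?_, ?_⟩
  · by_cases hu : u ∈ U
    · simpa [hu] using (hc u hu).trans (by exact_mod_cast hMN)
    · simp [hu]
  · simp only [ite_smul, zero_smul, Finset.sum_ite_mem, Finset.inter_eq_right.2 h]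

lemma intBox_add_subset {G : Type*} [AddCommGroup G] [DecidableEq G] (U : Finset G) (M N : ℕ) :
    intBox U M + intBox U N ⊆ intBox U (M + N) := by
  intro z hz
  obtain ⟨x, hx, y, hy, rfl⟩ := Finset.mem_add.1 hz
  obtain ⟨c, hc, rfl⟩ := mem_intBox.1 hx
  obtain ⟨d, hd, rfl⟩ := mem_intBox.1 hy
  refine mem_intBox.2 ⟨fun u => c u + d u, fun u hu => (abs_add_le _ _).trans ?_, ?_⟩
  · push_cast
    exact add_le_add (hc u hu) (hd u hu)
  · simp only [add_smul, Finset.sum_add_distrib]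

lemma nsmul_intBox_subset {G : Type*} [AddCommGroup G] [DecidableEq G] (U : Finset G) (N l : ℕ) :
    l • intBox U N ⊆ intBox U (l * N) := by
  induction l with
  | zero =>
    rw [zero_nsmul, Finset.zero_subset]
    exact zero_mem_intBox _ _
  | succ l ih =>
    rw [succ_nsmul, Nat.succ_mul]
    exact (Finset.add_subset_add_right ih).trans (intBox_add_subset _ _ _)

lemma subset_intBox_one {G : Type*} [AddCommGroup G] [DecidableEq G] (U : Finset G) :
    U ⊆ intBox U 1 := by
  intro u hu
  refine mem_intBox.2 ⟨fun x => if x = u then 1 else 0, fun x _ => ?_, ?_⟩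
  · dsimp only
    split_ifs <;> simp
  · simp [ite_smul, hu]

lemma sub_subset_intBox_one {G : Type*} [AddCommGroup G] [DecidableEq G] (U : Finset G) :
    U - U ⊆ intBox U 1 := by
  intro z hz
  obtain ⟨u, hu, v, hv, rfl⟩ := Finset.mem_sub.1 hz
  refine mem_intBox.2 ⟨fun x => (if x = u then 1 else 0) - (if x = v then 1 else 0),
    fun x _ => ?_, ?_⟩
  · dsimp only
    split_ifs <;> simp
  · simp [sub_smul, ite_smul, Finset.sum_sub_distrib, hu, hv]

/-- Either `Λ` contains `q` elements with disjoint translates of `P`, or fewer than `q`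
translates of `P - P` cover `Λ`. -/
lemma exists_disjoint_translates_or_cover {G : Type*} [AddCommGroup G] [DecidableEq G]
    {P : Finset G} (hP : P.Nonempty) (Λ : Finset G) (q : ℕ) :
    ∃ X ⊆ Λ, #X ≤ q ∧ (#(P + X) = #P * q ∨ Λ ⊆ (P - P) + X) := by
  obtain ⟨X, hX, hmax⟩ := Finset.exists_max_image
    ({X ∈ Λ.powerset | #X ≤ q ∧ #(P + X) = #P * #X}) Finset.card
    ⟨∅, Finset.mem_filter.2 ⟨Finset.empty_mem_powerset _, by simp⟩⟩
  obtain ⟨hXΛ, hXq, hXP⟩ := Finset.mem_filter.1 hX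
  rw [Finset.mem_powerset] at hXΛ
  refine ⟨X, hXΛ, hXq, ?_⟩
  rcases hXq.eq_or_lt with h | h
  · exact Or.inl (by rw [hXP, h])
  right
  intro x hx
  by_cases hxX : x ∈ X
  · obtain ⟨p, hp⟩ := hP
    simpa using Finset.add_mem_add (Finset.sub_mem_sub hp hp) hxX
  by_contra hcon
  have hdisj : Disjoint (P + {x}) (P + X) := by
    rw [Finset.disjoint_left]
    intro z hz hz'
    obtain ⟨p, hp, y, hy, rfl⟩ := Finset.mem_add.1 hz
    rw [Finset.mem_singleton] at hy
    subst hy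
    obtain ⟨p', hp', y', hy', he⟩ := Finset.mem_add.1 hz'
    refine hcon ?_
    have h2 := Finset.add_mem_add (Finset.sub_mem_sub hp' hp) hy'
    have h3 : p' - p + y' = y := by
      rw [sub_add_eq_add_sub, he, add_sub_cancel_left]
    rwa [h3] at h2
  have h1 := hmax (insert x X) (by
    refine Finset.mem_filter.2 ⟨Finset.mem_powerset.2 (Finset.insert_subset hx hXΛ), ?_, ?_⟩
    · rw [Finset.card_insert_of_notMem hxX]; omega
    · rw [Finset.insert_eq, Finset.add_union, Finset.card_union_of_disjoint hdisj, hXP,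
        ← Finset.insert_eq, Finset.card_insert_of_notMem hxX, Finset.card_add_singleton]
      ring)
  rw [Finset.card_insert_of_notMem hxX] at h1
  omega

/-- Chang's iteration of the Ruzsa covering argument. -/
lemma exists_growth_or_cover {G : Type*} [AddCommGroup G] [DecidableEq G]
    {P : Finset G} (hP : P.Nonempty) (Λ : Finset G) {q : ℕ} (hq : 0 < q) (s : ℕ) :
    ∃ U : Finset G, #U ≤ s * q ∧
      ((∃ Q ⊆ P + s • Λ, q ^ s * #P ≤ #Q ∧ Q - Q ⊆ (P - P) + intBox U s) ∨
        Λ ⊆ (P - P) + intBox U s) := by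
  induction s with
  | zero => exact ⟨∅, by simp, Or.inl ⟨P, by simp, by simp,
      fun z hz => by simpa using Finset.add_mem_add hz (zero_mem_intBox ∅ 0)⟩⟩
  | succ s ih =>
    obtain ⟨U, hU, ⟨Q, hQ, hQcard, hQU⟩ | hcov⟩ := ih
    · have hQne : Q.Nonempty := by
        rw [← Finset.card_pos]
        have := hP.card_pos
        exact lt_of_lt_of_le (by positivity) hQcard
      obtain ⟨X, hXΛ, hXq, hX⟩ := exists_disjoint_translates_or_cover hQne Λ q
      have hmono := intBox_mono (Finset.subset_union_left (s₁ := U) (s₂ := X)) (le_refl s)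
      have hone : intBox X 1 ⊆ intBox (U ∪ X) 1 := intBox_mono Finset.subset_union_right le_rfl
      have hcomb : ∀ Y ⊆ intBox X 1, (Q - Q) + Y ⊆ (P - P) + intBox (U ∪ X) (s + 1) := by
        intro Y hY
        refine (Finset.add_subset_add (hQU.trans (Finset.add_subset_add_left hmono))
          (hY.trans hone)).trans ?_
        rw [add_assoc]
        exact Finset.add_subset_add_left (intBox_add_subset _ _ _)
      refine ⟨U ∪ X, (Finset.card_union_le _ _).trans (by rw [Nat.succ_mul]; omega), ?_⟩
      rcases hX with hX | hX
      · refine Or.inl ⟨Q + X, ?_, ?_, ?_⟩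
        · rw [succ_nsmul, ← add_assoc]
          exact Finset.add_subset_add hQ hXΛ
        · rw [hX, pow_succ, mul_right_comm]
          exact Nat.mul_le_mul_right _ hQcard
        · rw [add_sub_add_comm]
          exact hcomb _ (sub_subset_intBox_one X)
      · exact Or.inr (hX.trans (hcomb _ (subset_intBox_one X)))
    · exact ⟨U, hU.trans (Nat.mul_le_mul_right _ (Nat.le_succ s)), Or.inr (hcov.trans
        (Finset.add_subset_add_left (intBox_mono subset_rfl (Nat.le_succ s))))⟩

lemma sum_nsmul_mem_nsmul {G : Type*} [AddCommGroup G] [DecidableEq G] {W V : Finset G}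
    (hV : V ⊆ W) (c : G → ℕ) : ∑ u ∈ V, c u • u ∈ (∑ u ∈ V, c u) • W := by
  induction V using Finset.induction_on with
  | empty => simp
  | insert a V ha ih =>
    rw [Finset.sum_insert ha, Finset.sum_insert ha, add_nsmul]
    exact Finset.add_mem_add (Finset.nsmul_mem_nsmul (hV (Finset.mem_insert_self _ _)))
      (ih ((Finset.subset_insert _ _).trans hV))

/-- The combinations of a `k`-dissociated set with coefficients in `[0, k]` are distinct. -/
lemma IsKDissociated.pow_le_card {G : Type*} [AddCommGroup G] [DecidableEq G] {k : ℕ}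
    {Λ W : Finset G} (hΛ : IsKDissociated k Λ) (hW : Λ ⊆ W) (h0 : 0 ∈ W) :
    (k + 1) ^ #Λ ≤ #((#Λ * k) • W) := by
  have h1 : #(Fintype.piFinset fun _ : Λ => Finset.range (k + 1)) = (k + 1) ^ #Λ := by
    rw [Fintype.card_piFinset, Finset.prod_const, Finset.card_univ, Fintype.card_coe,
      Finset.card_range]
  let ext : (Λ → ℕ) → G → ℕ := fun c x => if h : x ∈ Λ then c ⟨x, h⟩ else 0
  rw [← h1]
  refine Finset.card_le_card_of_injOn (fun c => ∑ u ∈ Λ, ext c u • u) ?_ ?_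
  · intro c hc
    rw [Finset.mem_coe, Fintype.mem_piFinset] at hc
    refine Finset.nsmul_subset_nsmul_right h0 ?_ (sum_nsmul_mem_nsmul hW (ext c))
    rw [← smul_eq_mul]
    refine Finset.sum_le_card_nsmul _ _ _ fun u hu => ?_
    have := Finset.mem_range.1 (hc ⟨u, hu⟩)
    simp only [ext, hu, dite_true]
    omega
  · intro c hc d hd hcd
    rw [Finset.mem_coe, Fintype.mem_piFinset] at hc hd
    have hrel : ∑ x ∈ Λ, ((ext c x : ℤ) - ext d x) • x = 0 := by
      simp only [sub_smul, natCast_zsmul, Finset.sum_sub_distrib]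
      exact sub_eq_zero.2 hcd
    have h2 := hΛ (fun x => (ext c x : ℤ) - ext d x) (fun x hx => by
      have h3 := Finset.mem_range.1 (hc ⟨x, hx⟩)
      have h4 := Finset.mem_range.1 (hd ⟨x, hx⟩)
      simp only [ext, hx, dite_true]
      rw [abs_le]
      omega) hrel
    funext u
    have h3 := h2 u u.2
    simp only [ext, u.2, dite_true, Subtype.coe_eta] at h3
    omega

/-- The counting inequality satisfied by a highly dissociated subset of a set of small
doubling. -/
lemma exists_pow_card_le : ∃ c : ℕ, 1 ≤ c ∧ ∀ {G : Type u} [AddCommGroup G] [DecidableEq G]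
    {A Λ : Finset G} {K : ℝ} {b w : ℕ}, A.Nonempty → (#(A + A) : ℝ) ≤ K * #A → 1 ≤ K →
    2 * K ≤ 2 ^ b → Λ ⊆ A → 1 ≤ #Λ → #Λ ≤ 2 ^ w → IsKDissociated #Λ Λ →
    ((#Λ : ℝ) + 1) ^ #Λ ≤ K ^ 20 * #A *
      (2 * (#Λ : ℝ) ^ 2 * (c * (w + 1) * b ^ 4) + 1) ^ (c * (w + 1) * b ^ 4 * 2 ^ b) := by
  obtain ⟨c, hc⟩ := exists_large_nsmul_subset.{u}
  refine ⟨5 + 8 * c, by omega, ?_⟩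
  intro G _ _ A Λ K b w hA hK hK1 hKb hΛA hD hDw hΛ
  have hK0 : 0 ≤ K := by linarith
  have hn : (0 : ℝ) < #A := by exact_mod_cast hA.card_pos
  have hb : 1 ≤ b := by
    rcases Nat.eq_zero_or_pos b with rfl | h
    · norm_num at hKb; linarith
    · exact h
  obtain ⟨D, hDdef⟩ : ∃ D, D = #Λ := ⟨_, rfl⟩
  rw [← hDdef] at hD hDw hΛ ⊢
  obtain ⟨P, hPA, hPne, hlP, hPcard⟩ := hc (l := D ^ 2) hA hK hb hK0 (by linarith) (by positivity)
  have hP0 : (0 : ℝ) < #P := by exact_mod_cast hPne.card_pos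
  obtain ⟨s, hs⟩ : ∃ s : ℕ, s = (5 + 8 * c) * (w + 1) * b ^ 4 := ⟨_, rfl⟩
  have hsb : 4 * b + 8 * (w + 1) * (c * b ^ 4) < s := by
    have h4 : b ≤ b ^ 4 := Nat.le_self_pow (by norm_num) b
    have : s = 5 * b ^ 4 + 5 * w * b ^ 4 + 8 * (w + 1) * (c * b ^ 4) := by rw [hs]; ring
    have : 0 ≤ 5 * w * b ^ 4 := Nat.zero_le _
    omega
  obtain ⟨U, hU, hcase⟩ := exists_growth_or_cover hPne Λ (q := 2 ^ b) (by positivity) s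
  have hcov : Λ ⊆ (P - P) + intBox U s := by
    refine hcase.resolve_left ?_
    rintro ⟨Q, hQ, hQcard, -⟩
    have h1 : Q ⊆ (2 + s) • A - 2 • A := by
      have h2 : P + s • Λ ⊆ (2 • A - 2 • A) + (s • A - 0 • A) :=
        Finset.add_subset_add hPA (by simpa using Finset.nsmul_subset_nsmul_left hΛA)
      rw [nsmul_sub_nsmul_add] at h2
      exact hQ.trans h2
    have h3 : (2 ^ b) ^ s * (#P : ℝ) ≤ K ^ (2 + s + 2) * #A := by
      refine le_trans ?_ (card_nsmul_sub_nsmul_le hA hK (2 + s) 2)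
      exact_mod_cast hQcard.trans (Finset.card_le_card h1)
    have h64 : (64 * (D ^ 2 : ℕ) : ℝ) ≤ 2 ^ (8 * (w + 1)) := by
      have h4 : (D : ℝ) ≤ 2 ^ w := by exact_mod_cast hDw
      push_cast
      calc (64 * (D : ℝ) ^ 2) ≤ 2 ^ 6 * (2 ^ w) ^ 2 := by
            gcongr
            norm_num
        _ = (2 : ℝ) ^ (6 + w * 2) := by rw [pow_add, pow_mul]
        _ ≤ _ := pow_le_pow_right₀ (by norm_num) (by omega)
    have h5 : (2 ^ b) ^ s * (#P : ℝ) ≤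
        K ^ s * 2 ^ (4 * b + 8 * (w + 1) * (c * b ^ 4)) * #P := by
      calc (2 ^ b) ^ s * (#P : ℝ) ≤ K ^ (2 + s + 2) * #A := h3
        _ = K ^ s * (K ^ 4 * #A) := by ring
        _ ≤ K ^ s * ((2 ^ b) ^ 4 * ((2 ^ (8 * (w + 1))) ^ (c * b ^ 4) * #P)) := by
            gcongr
            · linarith
            · exact hPcard.trans (by gcongr)
        _ = _ := by rw [← pow_mul, ← pow_mul, pow_add, mul_comm 4 b]; ring
    have h6 : (2 : ℝ) ^ s * K ^ s ≤ 2 ^ (4 * b + 8 * (w + 1) * (c * b ^ 4)) * K ^ s := by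
      rw [← mul_pow]
      refine le_trans (pow_le_pow_left₀ (by linarith) hKb s) ?_
      rw [mul_comm _ (K ^ s)]
      exact le_of_mul_le_mul_right h5 hP0
    have h7 := le_of_mul_le_mul_right h6 (by positivity)
    have h8 := (pow_le_pow_iff_right₀ (by norm_num : (1 : ℝ) < 2)).1 h7
    omega
  have hW0 : 0 ∈ (P - P) + intBox U s := by
    obtain ⟨p, hp⟩ := hPne
    simpa using Finset.add_mem_add (Finset.sub_mem_sub hp hp) (zero_mem_intBox U s)
  have hcount := hΛ.pow_le_card hcov hW0
  rw [← hDdef, ← sq, nsmul_add, nsmul_sub] at hcount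
  have hsub : D ^ 2 • P - D ^ 2 • P + D ^ 2 • intBox U s ⊆
      (10 • A - 10 • A) + intBox U (D ^ 2 * s) := by
    refine Finset.add_subset_add ?_ (nsmul_intBox_subset _ _ _)
    have := Finset.sub_subset_sub hlP hlP
    rwa [nsmul_sub_nsmul_sub] at this
  have h1 : (D + 1) ^ D ≤ #(10 • A - 10 • A) * (2 * (D ^ 2 * s) + 1) ^ (s * 2 ^ b) := by
    refine hcount.trans ((Finset.card_le_card hsub).trans (Finset.card_add_le.trans ?_))
    refine Nat.mul_le_mul_left _ ((card_intBox_le _ _).trans ?_)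
    exact Nat.pow_le_pow_right (by omega) hU
  have h2 : ((D : ℝ) + 1) ^ D ≤
      #(10 • A - 10 • A) * (2 * (D ^ 2 * s) + 1) ^ (s * 2 ^ b) := by exact_mod_cast h1
  have h3 := card_nsmul_sub_nsmul_le hA hK 10 10
  rw [← hs]
  have h4 : (s : ℝ) = ((5 + 8 * c : ℕ) : ℝ) * (w + 1) * b ^ 4 := by rw [hs]; push_cast; ring
  rw [← h4]
  calc ((D : ℝ) + 1) ^ D ≤ _ := h2
    _ ≤ K ^ 20 * #A * (2 * (D ^ 2 * s) + 1) ^ (s * 2 ^ b) := by gcongr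
    _ = _ := by rw [mul_assoc 2]

lemma logb_two_le_self {y : ℝ} (hy : 0 < y) : Real.logb 2 y ≤ y := by
  have h1 := Real.log_two_gt_d9
  have h2 := Real.log_le_sub_one_of_pos (show 0 < y / 2 by positivity)
  rw [Real.log_div hy.ne' (by norm_num)] at h2
  rw [Real.logb, div_le_iff₀ (by linarith)]
  have h3 := Real.log_two_lt_d9
  nlinarith

lemma logb_two_eq_two_mul_sqrt {y : ℝ} (hy : 0 ≤ y) : Real.logb 2 y = 2 * Real.logb 2 √y := by
  have h := Real.logb_pow 2 √y 2
  rw [Real.sq_sqrt hy] at h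
  exact_mod_cast h

lemma logb_two_le_two_mul_sqrt {y : ℝ} (hy : 0 < y) : Real.logb 2 y ≤ 2 * √y := by
  have h1 := logb_two_le_self (Real.sqrt_pos.2 hy)
  have h2 := logb_two_eq_two_mul_sqrt hy.le
  linarith

/-- If `D` exceeds a large multiple of `K * L ^ 6` then `K * L ^ 4 * log D` is small compared
to `D`. -/
lemma mul_logb_le {D K L E : ℝ} (hK : 1 ≤ K) (hL : L = Real.logb 2 (2 * K)) (hE : 1 ≤ E)
    (hD : E ^ 2 * (K * L ^ 6) ≤ D) : K * L ^ 4 * Real.logb 2 D ≤ 9 * D / E := by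
  have hL1 : 1 ≤ L := by
    rw [hL, Real.le_logb_iff_rpow_le (by norm_num) (by linarith)]
    norm_num
    linarith
  have hKL : 0 < K * L ^ 6 := by positivity
  obtain ⟨t, ht⟩ : ∃ t, t = D / (K * L ^ 6) := ⟨_, rfl⟩
  have htE : E ^ 2 ≤ t := by rwa [ht, le_div_iff₀ hKL]
  have ht0 : 0 < t := lt_of_lt_of_le (by positivity) htE
  have hDt : D = t * (K * L ^ 6) := by rw [ht]; field_simp
  have hlog : Real.logb 2 D ≤ 2 * √t + 7 * L := by
    rw [hDt, Real.logb_mul ht0.ne' hKL.ne', Real.logb_mul (by positivity) (by positivity),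
      Real.logb_pow]
    have h1 := logb_two_le_two_mul_sqrt ht0
    have h2 := logb_two_le_self (show 0 < L by linarith)
    have h3 : Real.logb 2 K ≤ L := by
      rw [hL]
      exact Real.logb_le_logb_of_le (by norm_num) (by linarith) (by linarith)
    push_cast
    linarith
  have hs0 : 0 ≤ √t := Real.sqrt_nonneg t
  have hsE : E ≤ √t := Real.le_sqrt_of_sq_le htE
  have hst : √t * √t = t := Real.mul_self_sqrt ht0.le
  have h4 : (2 * √t + 7 * L) * E ≤ 9 * t * L ^ 2 := by
    have h5 : √t * E ≤ t := by nlinarith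
    have h6 : E ≤ t := by nlinarith
    have h7 : t ≤ t * L ^ 2 := le_mul_of_one_le_right ht0.le (one_le_pow₀ hL1)
    have h8 : L * E ≤ t * L ^ 2 := by
      calc L * E ≤ L ^ 2 * t := by
            refine mul_le_mul ?_ h6 (by linarith) (by positivity)
            nlinarith
        _ = _ := mul_comm _ _
    nlinarith
  rw [le_div_iff₀ (by linarith)]
  calc K * L ^ 4 * Real.logb 2 D * E ≤ K * L ^ 4 * (2 * √t + 7 * L) * E := by gcongr
    _ = K * L ^ 4 * ((2 * √t + 7 * L) * E) := by ring
    _ ≤ K * L ^ 4 * (9 * t * L ^ 2) := by gcongr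
    _ = 9 * D := by rw [hDt]; ring

/-- If `D` exceeds `4 N / log N` then `D log D` exceeds `2 N`. -/
lemma mul_logb_gt {D N : ℝ} (hN : 2 ≤ N) (hD : 4 * (N / Real.logb 2 N) < D) :
    2 * N < D * Real.logb 2 D := by
  have hlogN : 1 ≤ Real.logb 2 N := by
    rw [Real.le_logb_iff_rpow_le (by norm_num) (by linarith)]
    simpa using hN
  have h1 := logb_two_le_two_mul_sqrt (show 0 < N by linarith)
  have hs : 0 < √N := Real.sqrt_pos.2 (by linarith)
  have hss : √N * √N = N := Real.mul_self_sqrt (by linarith)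
  have h2 : √N / 2 ≤ N / Real.logb 2 N := by
    rw [div_le_div_iff₀ (by norm_num) (by linarith)]
    nlinarith
  have h3 : √N ≤ D := by linarith
  have h4 : Real.logb 2 N ≤ 2 * Real.logb 2 D := by
    have h5 := Real.logb_le_logb_of_le (b := 2) (by norm_num) hs h3
    have h6 := logb_two_eq_two_mul_sqrt (show 0 ≤ N by linarith)
    linarith
  rw [← mul_div_assoc, div_lt_iff₀ (by linarith)] at hD
  nlinarith

/-- The numerical part of the dimension bound: solving the counting inequality for `D`. -/
lemma le_of_counting {c D n : ℕ} (hc : 1 ≤ c) {K : ℝ} (hn : 4 ≤ n) (hK : 1 ≤ K)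
    (h : ∀ b w : ℕ, 2 * K ≤ 2 ^ b → 1 ≤ D → D ≤ 2 ^ w → ((D : ℝ) + 1) ^ D ≤ K ^ 20 * n *
      (2 * (D : ℝ) ^ 2 * (c * (w + 1) * b ^ 4) + 1) ^ (c * (w + 1) * b ^ 4 * 2 ^ b)) :
    (D : ℝ) ≤ (34560 * (c : ℝ)) ^ 2 * (Real.logb 2 n / Real.logb 2 (Real.logb 2 n) +
      K * (Real.logb 2 (2 * K)) ^ 6 * Real.logb 2 (Real.logb 2 (4 * K))) := by
  by_contra! hcon
  have hc' : (1 : ℝ) ≤ c := by exact_mod_cast hc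
  have hn' : (4 : ℝ) ≤ n := by exact_mod_cast hn
  obtain ⟨E, hE⟩ : ∃ E : ℝ, E = 34560 * c := ⟨_, rfl⟩
  obtain ⟨L, hL⟩ : ∃ L, L = Real.logb 2 (2 * K) := ⟨_, rfl⟩
  obtain ⟨N, hN⟩ : ∃ N, N = Real.logb 2 n := ⟨_, rfl⟩
  rw [← hE, ← hL, ← hN] at hcon
  have hE1 : 34560 ≤ E := by rw [hE]; linarith
  have hL1 : 1 ≤ L := by
    rw [hL, Real.le_logb_iff_rpow_le (by norm_num) (by linarith)]
    norm_num
    linarith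
  have hN2 : 2 ≤ N := by
    rw [hN, Real.le_logb_iff_rpow_le (by norm_num) (by linarith)]
    norm_num
    linarith
  have hlogN : 1 ≤ Real.logb 2 N := by
    rw [Real.le_logb_iff_rpow_le (by norm_num) (by linarith)]
    simpa using hN2
  have hM : 1 ≤ Real.logb 2 (Real.logb 2 (4 * K)) := by
    have h1 : 2 ≤ Real.logb 2 (4 * K) := by
      rw [Real.le_logb_iff_rpow_le (by norm_num) (by linarith)]
      norm_num
      linarith
    rw [Real.le_logb_iff_rpow_le (by norm_num) (by linarith)]
    simpa using h1
  have hKL : 1 ≤ K * L ^ 6 := by nlinarith [one_le_pow₀ hL1 (n := 6)]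
  have hE2 : E ≤ E ^ 2 := by nlinarith
  have hNN : 0 ≤ N / Real.logb 2 N := by positivity
  have hD1 : E ^ 2 * (K * L ^ 6) ≤ D := by
    refine le_trans ?_ hcon.le
    gcongr
    nlinarith
  have hD2 : 4 * (N / Real.logb 2 N) < D := by
    refine lt_of_le_of_lt ?_ hcon
    have : 0 ≤ K * L ^ 6 * Real.logb 2 (Real.logb 2 (4 * K)) := by positivity
    refine mul_le_mul (by linarith) (by linarith) hNN (by positivity)
  have hDE : E ≤ D := by nlinarith
  have hD0 : (0 : ℝ) < D := by linarith
  have hsmall := mul_logb_le hK hL (by linarith) hD1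
  have hbig := mul_logb_gt hN2 hD2
  obtain ⟨x, hx⟩ : ∃ x, x = Real.logb 2 (D : ℝ) := ⟨_, rfl⟩
  rw [← hx] at hsmall hbig
  have hx1 : 1 ≤ x := by
    rw [hx, Real.le_logb_iff_rpow_le (by norm_num) (by linarith), Real.rpow_one]
    linarith
  have hb := h ⌈L⌉₊ ⌈x⌉₊ (by
      rw [← Real.rpow_natCast, ← Real.logb_le_iff_le_rpow (by norm_num) (by linarith), ← hL]
      exact Nat.le_ceil _) (by
      have : (1 : ℝ) ≤ D := by linarith
      exact_mod_cast this) (by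
      have : (D : ℝ) ≤ 2 ^ ⌈x⌉₊ := by
        rw [← Real.rpow_natCast, ← Real.logb_le_iff_le_rpow (by norm_num) (by linarith), ← hx]
        exact Nat.le_ceil _
      exact_mod_cast this)
  have hbL : (⌈L⌉₊ : ℝ) ≤ L + 1 := (Nat.ceil_lt_add_one (by linarith)).le
  have hwx : (⌈x⌉₊ : ℝ) ≤ x + 1 := (Nat.ceil_lt_add_one (by linarith)).le
  have h2b : (2 : ℝ) ^ ⌈L⌉₊ ≤ 4 * K := by
    rw [← Real.rpow_natCast]
    calc (2 : ℝ) ^ (⌈L⌉₊ : ℝ) ≤ 2 ^ (L + 1) := Real.rpow_le_rpow_of_exponent_le (by norm_num) hbL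
      _ = 4 * K := by
        rw [Real.rpow_add (by norm_num), hL, Real.rpow_logb (by norm_num) (by norm_num)
          (by linarith)]
        norm_num
        ring
  obtain ⟨s, hs⟩ : ∃ s : ℝ, s = c * ((⌈x⌉₊ : ℝ) + 1) * (⌈L⌉₊ : ℝ) ^ 4 := ⟨_, rfl⟩
  have hs0 : 0 ≤ s := by rw [hs]; positivity
  have hsx : s ≤ 48 * c * (L ^ 4 * x) := by
    rw [hs]
    calc c * ((⌈x⌉₊ : ℝ) + 1) * (⌈L⌉₊ : ℝ) ^ 4 ≤ c * (3 * x) * (2 * L) ^ 4 := by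
          gcongr <;> linarith
      _ = _ := by ring
  have hcE : 48 * (c : ℝ) = E / 720 := by rw [hE]; ring
  have hKs : K * s ≤ D / 80 := by
    calc K * s ≤ K * (48 * c * (L ^ 4 * x)) := by gcongr
      _ = E / 720 * (K * L ^ 4 * x) := by rw [← hcE]; ring
      _ ≤ E / 720 * (9 * D / E) := by gcongr
      _ = D / 80 := by field_simp; norm_num
  have hsD : s ≤ D := by nlinarith
  rw [← hs] at hb
  have hbase : Real.logb 2 (2 * (D : ℝ) ^ 2 * s + 1) ≤ 5 * x := by
    have h1 : 2 * (D : ℝ) ^ 2 * s + 1 ≤ (D : ℝ) ^ 5 := by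
      have h3 : (1 : ℝ) ≤ (D : ℝ) ^ 3 := one_le_pow₀ (by linarith)
      have h4 : (3 : ℝ) ≤ (D : ℝ) ^ 2 := by nlinarith
      calc 2 * (D : ℝ) ^ 2 * s + 1 ≤ 2 * (D : ℝ) ^ 2 * D + (D : ℝ) ^ 3 := by gcongr
        _ = 3 * (D : ℝ) ^ 3 := by ring
        _ ≤ (D : ℝ) ^ 2 * (D : ℝ) ^ 3 := by gcongr
        _ = _ := by ring
    have h2 := Real.logb_le_logb_of_le (b := 2) (by norm_num) (by positivity) h1
    rw [Real.logb_pow, ← hx] at h2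
    exact_mod_cast h2
  have hlog := Real.logb_le_logb_of_le (b := 2) (by norm_num) (by positivity) hb
  have hbase0 : 0 < 2 * (D : ℝ) ^ 2 * s + 1 := by positivity
  rw [Real.logb_pow, Real.logb_mul (by positivity) (by positivity),
    Real.logb_mul (by positivity) (by positivity), Real.logb_pow, Real.logb_pow, ← hN] at hlog
  have hleft : D * x ≤ D * Real.logb 2 ((D : ℝ) + 1) := by
    rw [hx]
    gcongr <;> linarith
  have hexp : ((c * (⌈x⌉₊ + 1) * ⌈L⌉₊ ^ 4 * 2 ^ ⌈L⌉₊ : ℕ) : ℝ) ≤ D / 20 := by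
    push_cast
    rw [← hs]
    calc s * 2 ^ ⌈L⌉₊ ≤ s * (4 * K) := by gcongr
      _ = 4 * (K * s) := by ring
      _ ≤ 4 * (D / 80) := by gcongr
      _ = D / 20 := by ring
  have hmain : ((c * (⌈x⌉₊ + 1) * ⌈L⌉₊ ^ 4 * 2 ^ ⌈L⌉₊ : ℕ) : ℝ) *
      Real.logb 2 (2 * (D : ℝ) ^ 2 * s + 1) ≤ D / 20 * (5 * x) :=
    mul_le_mul hexp hbase (Real.logb_nonneg (by norm_num) (le_add_of_nonneg_left (by positivity)))
      (by positivity)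
  have hlogK : 20 * Real.logb 2 K ≤ D * x / 4 := by
    have h1 : Real.logb 2 K ≤ K := logb_two_le_self (by linarith)
    have h2 : K ≤ K * L ^ 6 := le_mul_of_one_le_right (by linarith) (one_le_pow₀ hL1)
    have h3 : 80 * (K * L ^ 6) ≤ E ^ 2 * (K * L ^ 6) := by gcongr; linarith
    have h4 : (D : ℝ) ≤ D * x := le_mul_of_one_le_right hD0.le hx1
    linarith
  push_cast at hlog hmain
  linarith

lemma IsKDissociated.mono {G : Type*} [AddCommGroup G] {j k : ℕ} (hjk : j ≤ k) {Λ : Finset G}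
    (h : IsKDissociated k Λ) : IsKDissociated j Λ :=
  fun ε hε => h ε fun x hx => (hε x hx).trans (by exact_mod_cast hjk)

lemma bddAbove_card_isKDissociated {G : Type*} [AddCommGroup G] (k : ℕ) (A : Finset G) :
    BddAbove {n : ℕ | ∃ Λ : Finset G, Λ ⊆ A ∧ Λ.card = n ∧ IsKDissociated k Λ} := by
  refine ⟨#A, ?_⟩
  rintro n ⟨Λ, hΛ, rfl, -⟩
  exact Finset.card_le_card hΛ

lemma exists_card_eq_addDim {G : Type*} [AddCommGroup G] (k : ℕ) (A : Finset G) :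
    ∃ Λ : Finset G, Λ ⊆ A ∧ #Λ = addDim k A ∧ IsKDissociated k Λ :=
  Nat.sSup_mem (s := {n : ℕ | ∃ Λ : Finset G, Λ ⊆ A ∧ Λ.card = n ∧ IsKDissociated k Λ})
    ⟨0, ∅, Finset.empty_subset _, rfl, by simp [IsKDissociated]⟩ (bddAbove_card_isKDissociated k A)

lemma IsKDissociated.card_le_addDim {G : Type*} [AddCommGroup G] {k : ℕ} {A Λ : Finset G}
    (h : IsKDissociated k Λ) (hΛ : Λ ⊆ A) : #Λ ≤ addDim k A :=
  le_csSup (bddAbove_card_isKDissociated k A) ⟨Λ, hΛ, rfl, h⟩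

theorem stmt8 :
    ∃ C : ℝ, 0 < C ∧
      ∀ (G : Type u) [AddCommGroup G] [DecidableEq G] (A : Finset G) (K : ℝ),
        4 ≤ A.card → 2 ≤ addDim 1 A → 1 ≤ K →
        ((A + A).card : ℝ) ≤ K * A.card →
        ∀ k : ℕ, k = ⌈(addDim 1 A : ℝ) * Real.logb 2 (addDim 1 A)⌉₊ →
        (addDim k A : ℝ) ≤
          C * (Real.logb 2 A.card / Real.logb 2 (Real.logb 2 A.card) +
            K * (Real.logb 2 (2 * K)) ^ 6 * Real.logb 2 (Real.logb 2 (4 * K))) := by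
  obtain ⟨c, hc1, hc⟩ := exists_pow_card_le.{u}
  refine ⟨(34560 * (c : ℝ)) ^ 2, by positivity, ?_⟩
  intro G _ _ A K hA hdim hK1 hK k hk
  have hAne : A.Nonempty := Finset.card_pos.1 (by omega)
  have hdk : addDim 1 A ≤ k := by
    have h1 : (2 : ℝ) ≤ addDim 1 A := by exact_mod_cast hdim
    have h2 : 1 ≤ Real.logb 2 (addDim 1 A) := by
      rw [Real.le_logb_iff_rpow_le (by norm_num) (by linarith)]
      simpa using h1
    have h3 := Nat.le_ceil ((addDim 1 A : ℝ) * Real.logb 2 (addDim 1 A))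
    rw [← hk] at h3
    have h4 : (addDim 1 A : ℝ) ≤ k := by nlinarith
    exact_mod_cast h4
  obtain ⟨Λ, hΛA, hcard, hΛ⟩ := exists_card_eq_addDim k A
  have hΛd : #Λ ≤ addDim 1 A := (hΛ.mono (by omega)).card_le_addDim hΛA
  rw [← hcard]
  exact le_of_counting hc1 hA hK1 fun b w hb hD hw =>
    hc hAne hK hK1 hb hΛA hD hw (hΛ.mono (hΛd.trans hdk))
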